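/- arXiv:2509.08212 — 17 statements merged into one kernel-verified Lean document; each statement's English description precedes it below -/
import Mathlib

section
/- Under the stated sign assumptions on p″, there exist unique numbers τ₁ᵃ ∈ (1, τ₁ⁱ) and τ₂ᵃ ∈ (τ₂ⁱ, ∞) such that p′(τ₁ᵃ) = p′(τ₂ⁱ) and p′(τ₂ᵃ) = p′(τ₁ⁱ); in particular τ₁ᵃ < τ₁ⁱ < τ₂ⁱ < τ₂ᵃ. -/
open Real Set

/-- Under the stated sign assumptions on `p''`, there exist unique numbers
`τ₁ᵃ ∈ (1, τ₁ⁱ)` and `τ₂ᵃ ∈ (τ₂ⁱ, ∞)` such that `p'(τ₁ᵃ) = p'(τ₂ⁱ)` and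
`p'(τ₂ᵃ) = p'(τ₁ⁱ)`. -/
theorem stmt0
    (γ S : ℝ) (hγ1 : 1 < γ) (hγ2 : γ < 2) (hS : 0 < S)
    (p : ℝ → ℝ) (hpdef : ∀ τ : ℝ, p τ = S / (τ - 1) ^ γ - 1 / τ ^ 2)
    (τ1i τ2i : ℝ) (hτ1i : 1 < τ1i) (hτi : τ1i < τ2i)
    (hp' : ∀ τ : ℝ, 1 < τ → deriv p τ < 0)
    (hp''pos : ∀ τ : ℝ, (1 < τ ∧ τ < τ1i) ∨ τ2i < τ → 0 < deriv (deriv p) τ)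
    (hp''neg : ∀ τ : ℝ, τ1i < τ → τ < τ2i → deriv (deriv p) τ < 0)
    (h : ℝ → ℝ)
    (hh : ∀ τ : ℝ, 1 < τ → HasDerivAt h (τ * deriv p τ) τ) :
    (∃! a : ℝ, a ∈ Ioo 1 τ1i ∧ deriv p a = deriv p τ2i) ∧
    (∃! b : ℝ, b ∈ Ioi τ2i ∧ deriv p b = deriv p τ1i) := by
  have hd : ∀ τ : ℝ, 1 < τ → deriv p τ = 2 / τ ^ 3 - S * γ * (τ - 1) ^ (-γ - 1) := by
    intro τ hτ
    have h1 : HasDerivAt (fun t : ℝ => S * (t - 1) ^ (-γ) - (t ^ 2)⁻¹)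
        (S * (1 * (-γ) * (τ - 1) ^ (-γ - 1)) - (-(((2 : ℕ) : ℝ) * τ ^ (2 - 1)) / (τ ^ 2) ^ 2)) τ := by
      refine HasDerivAt.sub (HasDerivAt.const_mul S ?_) ?_
      · exact HasDerivAt.rpow_const ((hasDerivAt_id τ).sub_const 1) (Or.inl (by simp; linarith))
      · exact HasDerivAt.fun_inv (hasDerivAt_pow 2 τ) (by positivity)
    have h2 : p =ᶠ[nhds τ] (fun t : ℝ => S * (t - 1) ^ (-γ) - (t ^ 2)⁻¹) := by
      filter_upwards [Ioi_mem_nhds hτ] with t ht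
      have ht' : (1 : ℝ) < t := ht
      rw [hpdef, Real.rpow_neg (by linarith)]
      simp [div_eq_mul_inv]
    rw [h2.deriv_eq, h1.deriv]
    have : τ ≠ 0 := by linarith
    field_simp
    norm_num
    ring
  have hc : ContinuousOn (deriv p) (Ioi 1) := by
    have : ContinuousOn (fun τ : ℝ => 2 / τ ^ 3 - S * γ * (τ - 1) ^ (-γ - 1)) (Ioi 1) := by
      intro τ hτ
      have hτ' : (1 : ℝ) < τ := hτ
      apply ContinuousAt.continuousWithinAt
      refine ContinuousAt.sub (ContinuousAt.div (by fun_prop) (by fun_prop) (by positivity)) ?_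
      refine ContinuousAt.mul (by fun_prop) ?_
      exact ContinuousAt.rpow_const (by fun_prop) (Or.inl (by linarith))
    exact this.congr (fun τ hτ => hd τ hτ)
  have m1 : StrictMonoOn (deriv p) (Ioc 1 τ1i) := by
    apply strictMonoOn_of_deriv_pos (convex_Ioc _ _) (hc.mono fun x hx => hx.1)
    intro x hx
    rw [interior_Ioc] at hx
    exact hp''pos x (Or.inl hx)
  have m2 : StrictAntiOn (deriv p) (Icc τ1i τ2i) := by
    apply strictAntiOn_of_deriv_neg (convex_Icc _ _)
      (hc.mono fun x hx => lt_of_lt_of_le hτ1i hx.1)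
    intro x hx
    rw [interior_Icc] at hx
    exact hp''neg x hx.1 hx.2
  have m3 : StrictMonoOn (deriv p) (Ici τ2i) := by
    apply strictMonoOn_of_deriv_pos (convex_Ici _)
      (hc.mono fun x hx => lt_of_lt_of_le (hτ1i.trans hτi) hx)
    intro x hx
    rw [interior_Ici] at hx
    exact hp''pos x (Or.inr hx)
  have h12 : deriv p τ2i < deriv p τ1i :=
    m2 (left_mem_Icc.2 hτi.le) (right_mem_Icc.2 hτi.le) hτi
  constructor
  · have hlim : Filter.Tendsto (fun τ : ℝ => S * γ * (τ - 1) ^ (-γ - 1)) (nhdsWithin 1 (Ioi 1))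
        Filter.atTop := by
      apply Filter.Tendsto.const_mul_atTop (by positivity)
      have hs : Filter.Tendsto (fun τ : ℝ => τ - 1) (nhdsWithin 1 (Ioi 1))
          (nhdsWithin 0 (Ioi 0)) := by
        apply tendsto_nhdsWithin_of_tendsto_nhds_of_eventually_within
        · have : Filter.Tendsto (fun τ : ℝ => τ - 1) (nhds 1) (nhds (1 - 1)) :=
            (continuous_id.sub continuous_const).tendsto 1
          rw [sub_self] at this
          exact this.mono_left nhdsWithin_le_nhds
        · filter_upwards [self_mem_nhdsWithin] with t ht
          exact mem_Ioi.2 (sub_pos.2 (mem_Ioi.1 ht))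
      exact (tendsto_rpow_neg_nhdsGT_zero (by linarith : -γ - 1 < 0)).comp hs
    obtain ⟨c, hcgt, hcI⟩ := ((hlim.eventually_gt_atTop (2 - deriv p τ2i)).and
      (Ioo_mem_nhdsGT hτ1i)).exists
    have hc1 : deriv p c < deriv p τ2i := by
      rw [hd c hcI.1]
      have : 2 / c ^ 3 ≤ 2 := by
        apply div_le_self (by norm_num)
        exact one_le_pow₀ hcI.1.le
      linarith
    obtain ⟨a, ha, hae⟩ := intermediate_value_Ioo hcI.2.le
      (hc.mono fun x hx => lt_of_lt_of_le hcI.1 hx.1) ⟨hc1, h12⟩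
    have haI : a ∈ Ioo 1 τ1i := ⟨hcI.1.trans ha.1, ha.2⟩
    refine ⟨a, ⟨haI, hae⟩, ?_⟩
    rintro y ⟨hy, hye⟩
    exact m1.injOn ⟨hy.1, hy.2.le⟩ ⟨haI.1, haI.2.le⟩ (hye.trans hae.symm)
  · have hlim : Filter.Tendsto (fun τ : ℝ => S * γ * (τ - 1) ^ (-γ - 1)) Filter.atTop
        (nhds 0) := by
      have h1 : Filter.Tendsto (fun τ : ℝ => (τ - 1) ^ (-(γ + 1))) Filter.atTop (nhds 0) :=
        (tendsto_rpow_neg_atTop (by linarith : 0 < γ + 1)).comp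
          (Filter.tendsto_atTop_add_const_right _ (-1) Filter.tendsto_id)
      have h2 := h1.const_mul (S * γ)
      rw [mul_zero, neg_add'] at h2
      exact h2
    obtain ⟨d, hdl, hdI⟩ := ((hlim.eventually_lt_const
      (neg_pos.2 (hp' τ1i hτ1i))).and (Filter.eventually_gt_atTop τ2i)).exists
    have hd1 : 1 < d := hτ1i.trans (hτi.trans hdI)
    have hc1 : deriv p τ1i < deriv p d := by
      rw [hd d hd1]
      have : 0 < 2 / d ^ 3 := by positivity
      linarith
    obtain ⟨b, hb, hbe⟩ := intermediate_value_Ioo hdI.le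
      (hc.mono fun x hx => lt_of_lt_of_le (hτ1i.trans hτi) hx.1) ⟨h12, hc1⟩
    refine ⟨b, ⟨hb.1, hbe⟩, ?_⟩
    rintro y ⟨hy, hye⟩
    exact m3.injOn (mem_Ici.2 (le_of_lt (mem_Ioi.1 hy))) (mem_Ici.2 hb.1.le) (hye.trans hbe.symm)
end

section
/- There exists a unique τ_c ∈ (τ₁ⁱ, ∞) such that p′(τ₁ⁱ) = (2h(τ_c)−2h(τ₁ⁱ))/(τ_c²−(τ₁ⁱ)²). Moreover this τ_c satisfies p′(τ₁ⁱ) < p′(τ_c), τ_c > τ₂ᵃ, and p′(τ₁ⁱ) > (2h(τ)−2h(τ₁ⁱ))/(τ²−(τ₁ⁱ)²) for every τ ∈ (τ₁ⁱ, τ_c). -/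
open Real Set

/-- There exists a unique `τ_c ∈ (τ₁ⁱ, ∞)` with
`p'(τ₁ⁱ) = (2h(τ_c) − 2h(τ₁ⁱ))/(τ_c² − (τ₁ⁱ)²)`; moreover this `τ_c` satisfies
`p'(τ₁ⁱ) < p'(τ_c)`, `τ_c > τ₂ᵃ`, and
`p'(τ₁ⁱ) > (2h(τ) − 2h(τ₁ⁱ))/(τ² − (τ₁ⁱ)²)` for every `τ ∈ (τ₁ⁱ, τ_c)`. -/
theorem stmt1
    (γ S : ℝ) (hγ1 : 1 < γ) (hγ2 : γ < 2) (hS : 0 < S)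
    (p : ℝ → ℝ) (hpdef : ∀ τ : ℝ, p τ = S / (τ - 1) ^ γ - 1 / τ ^ 2)
    (τ1i τ2i : ℝ) (hτ1i : 1 < τ1i) (hτi : τ1i < τ2i)
    (hp' : ∀ τ : ℝ, 1 < τ → deriv p τ < 0)
    (hp''pos : ∀ τ : ℝ, (1 < τ ∧ τ < τ1i) ∨ τ2i < τ → 0 < deriv (deriv p) τ)
    (hp''neg : ∀ τ : ℝ, τ1i < τ → τ < τ2i → deriv (deriv p) τ < 0)
    (h : ℝ → ℝ)
    (hh : ∀ τ : ℝ, 1 < τ → HasDerivAt h (τ * deriv p τ) τ)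
    (τ2a : ℝ) (hτ2a : τ2i < τ2a) (hτ2a' : deriv p τ2a = deriv p τ1i) :
    ∃ c : ℝ,
      (c ∈ Ioi τ1i ∧ deriv p τ1i = (2 * h c - 2 * h τ1i) / (c ^ 2 - τ1i ^ 2)) ∧
      (∀ c' : ℝ, (c' ∈ Ioi τ1i ∧
          deriv p τ1i = (2 * h c' - 2 * h τ1i) / (c' ^ 2 - τ1i ^ 2)) → c' = c) ∧
      deriv p τ1i < deriv p c ∧
      τ2a < c ∧
      ∀ τ ∈ Ioo τ1i c,
        (2 * h τ - 2 * h τ1i) / (τ ^ 2 - τ1i ^ 2) < deriv p τ1i := by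
  have hcd : ContDiffOn ℝ 2 p (Ioi 1) := by
    intro x hx
    have hx1 : (1:ℝ) < x := hx
    apply ContDiffAt.contDiffWithinAt
    have e : p = fun τ : ℝ => S / (τ - 1) ^ γ - 1 / τ ^ 2 := funext hpdef
    rw [e]
    have h1 : ContDiffAt ℝ 2 (fun τ : ℝ => (τ - 1) ^ γ) x :=
      ContDiffAt.rpow_const_of_ne (by fun_prop) (by linarith)
    have h2 : (x - 1) ^ γ ≠ 0 := (Real.rpow_pos_of_pos (by linarith) _).ne'
    have h3 : x ^ 2 ≠ 0 := by positivity
    exact (contDiffAt_const.div h1 h2).sub (contDiffAt_const.div (by fun_prop) h3)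
  have hqc : ContinuousOn (deriv p) (Ioi 1) :=
    hcd.continuousOn_deriv_of_isOpen isOpen_Ioi (by norm_num)
  generalize deriv p = q at *
  have hanti : StrictAntiOn q (Icc τ1i τ2i) := by
    apply strictAntiOn_of_deriv_neg (convex_Icc _ _)
    · exact hqc.mono fun x hx => lt_of_lt_of_le hτ1i hx.1
    · intro x hx
      rw [interior_Icc] at hx
      exact hp''neg x hx.1 hx.2
  have hmono : StrictMonoOn q (Ici τ2i) := by
    apply strictMonoOn_of_deriv_pos (convex_Ici _)
    · exact hqc.mono fun x hx => lt_of_lt_of_le (hτ1i.trans hτi) hx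
    · intro x hx
      rw [interior_Ici] at hx
      exact hp''pos x (Or.inr hx)
  have hlt : ∀ x, τ1i < x → x < τ2a → q x < q τ1i := by
    intro x h1 h2
    rcases le_total x τ2i with h3 | h3
    · exact hanti ⟨le_rfl, hτi.le⟩ ⟨h1.le, h3⟩ h1
    · rw [← hτ2a']
      exact hmono h3 hτ2a.le h2
  have hgt : ∀ x, τ2a < x → q τ1i < q x := by
    intro x h1
    rw [← hτ2a']
    exact hmono hτ2a.le (hτ2a.trans h1).le h1
  set K := q τ1i with hK
  obtain ⟨G, hG⟩ : ∃ G : ℝ → ℝ, G = fun τ => 2 * h τ - 2 * h τ1i - K * (τ ^ 2 - τ1i ^ 2) := ⟨_, rfl⟩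
  have hGv : ∀ τ, G τ = 2 * h τ - 2 * h τ1i - K * (τ ^ 2 - τ1i ^ 2) := fun τ => by rw [hG]
  have hGd : ∀ x, 1 < x → HasDerivAt G (2 * x * (q x - K)) x := by
    intro x hx
    rw [hG]
    have := (((hh x hx).const_mul 2).sub_const (2 * h τ1i)).sub
      (((hasDerivAt_pow 2 x).sub_const (τ1i ^ 2)).const_mul K)
    refine this.congr_deriv ?_
    push_cast
    ring
  have hGc : ContinuousOn G (Ioi 1) := fun x hx => (hGd x hx).continuousAt.continuousWithinAt
  have h12 : τ1i < τ2a := hτi.trans hτ2a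
  have hGanti : StrictAntiOn G (Icc τ1i τ2a) := by
    apply strictAntiOn_of_deriv_neg (convex_Icc _ _)
    · exact hGc.mono fun x hx => lt_of_lt_of_le hτ1i hx.1
    · intro x hx
      rw [interior_Icc] at hx
      have h1 : 1 < x := hτ1i.trans hx.1
      rw [(hGd x h1).deriv]
      exact mul_neg_of_pos_of_neg (by linarith) (by linarith [hlt x hx.1 hx.2])
  have hGmono : StrictMonoOn G (Ici τ2a) := by
    apply strictMonoOn_of_deriv_pos (convex_Ici _)
    · exact hGc.mono fun x hx => lt_of_lt_of_le (hτ1i.trans h12) hx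
    · intro x hx
      rw [interior_Ici] at hx
      have hx2 : τ2a < x := hx
      have h1 : 1 < x := by linarith
      rw [(hGd x h1).deriv]
      exact mul_pos (by linarith) (by linarith [hgt x hx2])
  have hG0 : G τ1i = 0 := by rw [hGv]; ring
  have hneg : ∀ x, τ1i < x → x ≤ τ2a → G x < 0 := by
    intro x h1 h2
    rw [← hG0]
    exact hGanti ⟨le_rfl, h12.le⟩ ⟨h1.le, h2⟩ h1
  -- linear growth at infinity
  obtain ⟨T, hT, hGT⟩ : ∃ T, τ2a < T ∧ 0 < G T := by
    obtain ⟨b, hb⟩ : ∃ b, b = τ2a + 1 := ⟨_, rfl⟩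
    have hδ : 0 < q b - K := by linarith [hgt b (by linarith)]
    have hd : ∀ x, 1 < x → HasDerivAt (fun t => G t - (q b - K) * t)
        (2 * x * (q x - K) - (q b - K) * 1) x := fun x hx =>
      (hGd x hx).sub ((hasDerivAt_id x).const_mul _)
    have hm : MonotoneOn (fun t => G t - (q b - K) * t) (Ici b) := by
      apply monotoneOn_of_deriv_nonneg (convex_Ici _)
      · intro x hx
        have hx' : b ≤ x := hx
        exact (hd x (by linarith)).continuousAt.continuousWithinAt
      · intro x hx
        rw [interior_Ici] at hx
        have hx' : b < x := hx
        exact (hd x (by linarith)).differentiableAt.differentiableWithinAt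
      · intro x hx
        rw [interior_Ici] at hx
        have hx' : b < x := hx
        rw [(hd x (by linarith)).deriv]
        have : q b < q x := hmono (show τ2i ≤ b by linarith) (show τ2i ≤ x by linarith) hx'
        nlinarith
    have ht : 0 ≤ |G b| / (q b - K) := by positivity
    refine ⟨b + |G b| / (q b - K) + 1, by linarith, ?_⟩
    have := hm (show b ≤ b by rfl) (show b ≤ b + |G b| / (q b - K) + 1 by linarith) (by linarith)
    simp only at this
    have e : (q b - K) * (b + |G b| / (q b - K) + 1) = (q b - K) * b + |G b| + (q b - K) := by
      field_simp
    rw [e] at this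
    linarith [neg_abs_le (G b)]
  obtain ⟨c, hc, hc0⟩ : ∃ c ∈ Ioo τ2a T, G c = 0 := by
    have := intermediate_value_Ioo hT.le
      (hGc.mono fun x (hx : x ∈ Icc τ2a T) => lt_of_lt_of_le (hτ1i.trans h12) hx.1)
    exact this ⟨hneg _ h12 le_rfl, hGT⟩
  have hden : ∀ x, τ1i < x → 0 < x ^ 2 - τ1i ^ 2 := fun x hx => by nlinarith
  have hc1 : τ1i < c := h12.trans hc.1
  refine ⟨c, ⟨hc1, ?_⟩, ?_, hgt c hc.1, hc.1, ?_⟩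
  · rw [eq_div_iff (hden c hc1).ne']
    linarith [hGv c]
  · rintro c' ⟨h1, h2⟩
    have h1' : τ1i < c' := h1
    rw [eq_div_iff (hden c' h1').ne'] at h2
    have h0 : G c' = 0 := by linarith [hGv c']
    have h3 : τ2a < c' := by
      by_contra hcon
      linarith [hneg c' h1' (not_lt.mp hcon)]
    exact hGmono.injOn h3.le hc.1.le (h0.trans hc0.symm)
  · intro τ hτ
    rw [div_lt_iff₀ (hden τ hτ.1)]
    have : G τ < 0 := by
      rcases le_total τ τ2a with h3 | h3
      · exact hneg τ hτ.1 h3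
      · rw [← hc0]
        exact hGmono h3 hc.1.le hτ.2
    linarith [hGv τ]
end

section
/- Suppose τ_f ∈ (τ_c, ∞). Then p′(τ) < (2h(τ)−2h(τ_f))/(τ²−τ_f²) < p′(τ_f) for every τ ∈ (1, τ_f). -/
open Real Set

/-- Suppose `τ_f ∈ (τ_c, ∞)`. Then
`p'(τ) < (2h(τ)−2h(τ_f))/(τ²−τ_f²) < p'(τ_f)` for every `τ ∈ (1, τ_f)`. -/
theorem stmt2
    (γ S : ℝ) (hγ1 : 1 < γ) (hγ2 : γ < 2) (hS : 0 < S)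
    (p : ℝ → ℝ) (hpdef : ∀ τ : ℝ, p τ = S / (τ - 1) ^ γ - 1 / τ ^ 2)
    (τ1i τ2i : ℝ) (hτ1i : 1 < τ1i) (hτi : τ1i < τ2i)
    (hp' : ∀ τ : ℝ, 1 < τ → deriv p τ < 0)
    (hp''pos : ∀ τ : ℝ, (1 < τ ∧ τ < τ1i) ∨ τ2i < τ → 0 < deriv (deriv p) τ)
    (hp''neg : ∀ τ : ℝ, τ1i < τ → τ < τ2i → deriv (deriv p) τ < 0)
    (h : ℝ → ℝ)
    (hh : ∀ τ : ℝ, 1 < τ → HasDerivAt h (τ * deriv p τ) τ)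
    (τc : ℝ) (hτc : τ1i < τc)
    (hτceq : deriv p τ1i = (2 * h τc - 2 * h τ1i) / (τc ^ 2 - τ1i ^ 2))
    (τf : ℝ) (hτf : τc < τf) :
    ∀ τ ∈ Ioo 1 τf,
      deriv p τ < (2 * h τ - 2 * h τf) / (τ ^ 2 - τf ^ 2) ∧
      (2 * h τ - 2 * h τf) / (τ ^ 2 - τf ^ 2) < deriv p τf := by
  have hsm : ∀ τ : ℝ, 1 < τ → ContDiffAt ℝ 3 p τ := by
    intro τ hτ
    have e : p = fun τ : ℝ => S / (τ - 1) ^ γ - 1 / τ ^ 2 := funext hpdef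
    rw [e]
    have h1 : τ - 1 ≠ 0 := by linarith
    have h2 : (τ - 1) ^ γ ≠ 0 := (Real.rpow_pos_of_pos (by linarith) γ).ne'
    have h3 : τ ^ 2 ≠ 0 := by positivity
    exact (contDiffAt_const.div
      ((contDiffAt_id.sub contDiffAt_const).rpow_const_of_ne h1) h2).sub
      (contDiffAt_const.div (contDiffAt_id.pow 2) h3)
  have hqd : ∀ τ : ℝ, 1 < τ → HasDerivAt (deriv p) (deriv (deriv p) τ) τ := by
    intro τ hτ
    have h1 : ContDiffAt ℝ 2 (deriv p) τ := by
      have := (hsm τ hτ).derivWithin (m := 2) (by norm_num)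
      simpa using this
    exact (h1.differentiableAt (by norm_num)).hasDerivAt
  clear hsm hpdef
  generalize hq : deriv p = q at *
  have hqc : ∀ s : Set ℝ, (∀ x ∈ s, 1 < x) → ContinuousOn q s := fun s hs x hx =>
    (hqd x (hs x hx)).continuousAt.continuousWithinAt
  have m1 : StrictMonoOn q (Ioc 1 τ1i) := by
    apply strictMonoOn_of_deriv_pos (convex_Ioc _ _) (hqc _ fun x hx => hx.1)
    intro x hx
    rw [interior_Ioc] at hx
    exact hp''pos x (Or.inl hx)
  have m2 : StrictAntiOn q (Icc τ1i τ2i) := by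
    apply strictAntiOn_of_deriv_neg (convex_Icc _ _) (hqc _ fun x hx => by linarith [hx.1])
    intro x hx
    rw [interior_Icc] at hx
    exact hp''neg x hx.1 hx.2
  have m3 : StrictMonoOn q (Ici τ2i) := by
    apply strictMonoOn_of_deriv_pos (convex_Ici _)
      (hqc _ fun x hx => by linarith [mem_Ici.1 hx])
    intro x hx
    rw [interior_Ici] at hx
    exact hp''pos x (Or.inr hx)
  have dH : ∀ a b c t : ℝ, 1 < t →
      HasDerivAt (fun t => 2 * h t - c - a * (t ^ 2 - b)) (2 * t * (q t - a)) t := by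
    intro a b c t ht
    have := (((hh t ht).const_mul 2).sub_const c).sub
      ((((hasDerivAt_id t).pow 2).sub_const b).const_mul a)
    refine HasDerivAt.congr_deriv this ?_
    simp only [id, Nat.cast_ofNat, Pi.pow_apply]
    ring
  have hc0 : 2 * h τc - 2 * h τ1i - q τ1i * (τc ^ 2 - τ1i ^ 2) = 0 := by
    have : τc ^ 2 - τ1i ^ 2 ≠ 0 := by nlinarith
    rw [hτceq]
    field_simp
    ring
  obtain ⟨t, ht, hqt⟩ : ∃ t ∈ Ioo τ1i τc, 2 * t * (q t - q τ1i) = 0 := by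
    apply exists_hasDerivAt_eq_zero (f := fun t => 2 * h t - 2 * h τ1i - q τ1i * (t ^ 2 - τ1i ^ 2))
      hτc
    · intro x hx
      exact (dH _ _ _ x (by linarith [hx.1])).continuousAt.continuousWithinAt
    · simp only [hc0]; ring
    · intro x hx
      exact dH _ _ _ x (by linarith [hx.1])
  have hqt' : q t = q τ1i := by
    have : 2 * t ≠ 0 := by linarith [ht.1]
    have := (mul_eq_zero.1 hqt).resolve_left this
    linarith
  have ht2 : τ2i < t := by
    by_contra! hc
    have := m2 ⟨le_rfl, hτi.le⟩ ⟨ht.1.le, hc⟩ ht.1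
    linarith
  have hbig : ∀ x, τc ≤ x → q τ1i < q x := by
    intro x hx
    rw [← hqt']
    exact m3 ht2.le (mem_Ici.2 (by linarith [ht.2])) (by linarith [ht.2])
  have hmax : ∀ x, 1 < x → x < τf → q x < q τf := by
    intro x h1 hx
    have hb := hbig τf hτf.le
    rcases le_total x τ1i with h2 | h2
    · have := m1.monotoneOn ⟨h1, h2⟩ ⟨hτ1i, le_rfl⟩ h2
      linarith
    rcases le_total x τ2i with h3 | h3
    · have := m2.antitoneOn ⟨le_rfl, hτi.le⟩ ⟨h2, h3⟩ h2
      linarith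
    exact m3 h3 (mem_Ici.2 (by linarith)) hx
  have hHf : 0 < 2 * h τf - 2 * h τ1i - q τ1i * (τf ^ 2 - τ1i ^ 2) := by
    rw [← hc0]
    have : StrictMonoOn (fun t => 2 * h t - 2 * h τ1i - q τ1i * (t ^ 2 - τ1i ^ 2))
        (Icc τc τf) := by
      apply strictMonoOn_of_deriv_pos (convex_Icc _ _)
      · intro x hx
        exact (dH _ _ _ x (by linarith [hx.1])).continuousAt.continuousWithinAt
      · intro x hx
        rw [interior_Icc] at hx
        rw [(dH _ _ _ x (by linarith [hx.1])).deriv]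
        have := hbig x hx.1.le
        have : 0 < x := by linarith [hx.1]
        exact mul_pos (by linarith) (by linarith)
    exact this ⟨le_rfl, hτf.le⟩ ⟨hτf.le, le_rfl⟩ hτf
  let G : ℝ → ℝ := fun x => 2 * h τf - 2 * h x - q x * (τf ^ 2 - x ^ 2)
  have dG : ∀ x, 1 < x → HasDerivAt G (-(deriv q x * (τf ^ 2 - x ^ 2))) x := by
    intro x hx
    have := (((hh x hx).const_mul 2).const_sub (2 * h τf)).sub
      ((hqd x hx).mul (((hasDerivAt_id x).pow 2).const_sub (τf ^ 2)))
    refine HasDerivAt.congr_deriv this ?_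
    simp only [id, Nat.cast_ofNat, Pi.pow_apply]
    ring
  have cG : ∀ s : Set ℝ, (∀ x ∈ s, 1 < x) → ContinuousOn G s := fun s hs x hx =>
    (dG x (hs x hx)).continuousAt.continuousWithinAt
  have hsq : ∀ x, 1 < x → x < τf → 0 < τf ^ 2 - x ^ 2 := by
    intro x h1 h2
    nlinarith
  have g1 : StrictAntiOn G (Ioc 1 τ1i) := by
    apply strictAntiOn_of_deriv_neg (convex_Ioc _ _) (cG _ fun x hx => hx.1)
    intro x hx
    rw [interior_Ioc] at hx
    rw [(dG x hx.1).deriv]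
    have := mul_pos (hp''pos x (Or.inl hx)) (hsq x hx.1 (by linarith [hx.2]))
    linarith
  have g2 : StrictMonoOn G (Icc τ1i τ2i) := by
    apply strictMonoOn_of_deriv_pos (convex_Icc _ _) (cG _ fun x hx => by linarith [hx.1])
    intro x hx
    rw [interior_Icc] at hx
    rw [(dG x (by linarith [hx.1])).deriv]
    have := mul_neg_of_neg_of_pos (hp''neg x hx.1 hx.2)
      (hsq x (by linarith [hx.1]) (by linarith [hx.2, ht.2]))
    linarith
  have g3 : StrictAntiOn G (Icc τ2i τf) := by
    apply strictAntiOn_of_deriv_neg (convex_Icc _ _) (cG _ fun x hx => by linarith [hx.1])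
    intro x hx
    rw [interior_Icc] at hx
    rw [(dG x (by linarith [hx.1])).deriv]
    have := mul_pos (hp''pos x (Or.inr hx.1)) (hsq x (by linarith [hx.1]) hx.2)
    linarith
  have hG1 : 0 < G τ1i := hHf
  have hGf : G τf = 0 := by simp [G]
  intro τ hτ
  have hGpos : 0 < G τ := by
    rcases le_total τ τ1i with h2 | h2
    · have := g1.antitoneOn ⟨hτ.1, h2⟩ ⟨hτ1i, le_rfl⟩ h2
      linarith
    rcases le_total τ τ2i with h3 | h3
    · have := g2.monotoneOn ⟨le_rfl, hτi.le⟩ ⟨h2, h3⟩ h2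
      linarith
    have := g3 ⟨h3, hτ.2.le⟩ ⟨by linarith [ht.2], le_rfl⟩ hτ.2
    linarith
  have hF : 2 * h τf - 2 * h τf - q τf * (τf ^ 2 - τf ^ 2) <
      2 * h τ - 2 * h τf - q τf * (τ ^ 2 - τf ^ 2) := by
    have : StrictAntiOn (fun t => 2 * h t - 2 * h τf - q τf * (t ^ 2 - τf ^ 2))
        (Icc τ τf) := by
      apply strictAntiOn_of_deriv_neg (convex_Icc _ _)
      · intro x hx
        exact (dH _ _ _ x (by linarith [hx.1, hτ.1])).continuousAt.continuousWithinAt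
      · intro x hx
        rw [interior_Icc] at hx
        have h1 : 1 < x := by linarith [hx.1, hτ.1]
        rw [(dH _ _ _ x h1).deriv]
        have := hmax x h1 hx.2
        exact mul_neg_of_pos_of_neg (by linarith) (by linarith)
    exact this ⟨le_rfl, hτ.2.le⟩ ⟨hτ.2.le, le_rfl⟩ hτ.2
  have hs := hsq τ hτ.1 hτ.2
  have hneg : τ ^ 2 - τf ^ 2 < 0 := by linarith
  have hGe : 0 < 2 * h τf - 2 * h τ - q τ * (τf ^ 2 - τ ^ 2) := hGpos
  constructor
  · rw [lt_div_iff_of_neg hneg]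
    linarith
  · rw [div_lt_iff_of_neg hneg]
    linarith
end

section
/- Suppose τ_f ∈ (τ_c, ∞). Then for every τ_b ∈ (1, τ_f), Liu's extended entropy condition holds for the pair (τ_b, τ_f): (2h(τ_f)−2h(τ_b))/(τ_f²−τ_b²) < (2h(τ_f)−2h(τ))/(τ_f²−τ²) for all τ ∈ (τ_b, τ_f). -/
open Real Set

/-- Suppose `τ_f ∈ (τ_c, ∞)`. Then for every `τ_b ∈ (1, τ_f)`, Liu's extended
entropy condition holds for the pair `(τ_b, τ_f)`. -/
theorem stmt3
    (γ S : ℝ) (hγ1 : 1 < γ) (hγ2 : γ < 2) (hS : 0 < S)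
    (p : ℝ → ℝ) (hpdef : ∀ τ : ℝ, p τ = S / (τ - 1) ^ γ - 1 / τ ^ 2)
    (τ1i τ2i : ℝ) (hτ1i : 1 < τ1i) (hτi : τ1i < τ2i)
    (hp' : ∀ τ : ℝ, 1 < τ → deriv p τ < 0)
    (hp''pos : ∀ τ : ℝ, (1 < τ ∧ τ < τ1i) ∨ τ2i < τ → 0 < deriv (deriv p) τ)
    (hp''neg : ∀ τ : ℝ, τ1i < τ → τ < τ2i → deriv (deriv p) τ < 0)
    (h : ℝ → ℝ)
    (hh : ∀ τ : ℝ, 1 < τ → HasDerivAt h (τ * deriv p τ) τ)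
    (τc : ℝ) (hτc : τ1i < τc)
    (hτceq : deriv p τ1i = (2 * h τc - 2 * h τ1i) / (τc ^ 2 - τ1i ^ 2))
    (τf : ℝ) (hτf : τc < τf) :
    ∀ τb ∈ Ioo 1 τf, ∀ τ ∈ Ioo τb τf,
      (2 * h τf - 2 * h τb) / (τf ^ 2 - τb ^ 2) <
        (2 * h τf - 2 * h τ) / (τf ^ 2 - τ ^ 2) := by
  have hpf : p = fun τ : ℝ => S / (τ - 1) ^ γ - 1 / τ ^ 2 := funext hpdef
  have hC : ContDiffOn ℝ 2 p (Ioi 1) := by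
    intro x hx
    have hx : (1:ℝ) < x := hx
    apply ContDiffAt.contDiffWithinAt
    rw [hpf]
    have h1 : (x - 1) ≠ 0 := by linarith
    have h2 : (x - 1) ^ γ ≠ 0 := (Real.rpow_pos_of_pos (by linarith) _).ne'
    have h3 : x ^ 2 ≠ 0 := by positivity
    have h4 : ContDiffAt ℝ 2 (fun τ : ℝ => (τ - 1) ^ γ) x :=
      ContDiffAt.rpow_const_of_ne (by fun_prop) h1
    exact (contDiffAt_const.div h4 h2).sub (contDiffAt_const.div (by fun_prop) h3)
  have hC1 : ContDiffOn ℝ 1 (deriv p) (Ioi 1) :=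
    hC.deriv_of_isOpen isOpen_Ioi (by norm_num)
  generalize deriv p = q at *
  have hq : ∀ x, 1 < x → HasDerivAt q (deriv q x) x := fun x hx =>
    ((hC1.differentiableOn (by norm_num)).differentiableAt (Ioi_mem_nhds hx)).hasDerivAt
  have hqc : ∀ s ⊆ Ioi (1:ℝ), ContinuousOn q s := fun s hs => hC1.continuousOn.mono hs
  have hqanti : StrictAntiOn q (Icc τ1i τ2i) := by
    apply strictAntiOn_of_deriv_neg (convex_Icc _ _)
      (hqc _ fun x hx => lt_of_lt_of_le hτ1i hx.1)
    intro x hx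
    rw [interior_Icc] at hx
    exact hp''neg x hx.1 hx.2
  have hqmono : StrictMonoOn q (Ici τ2i) := by
    apply strictMonoOn_of_deriv_pos (convex_Ici _)
      (hqc _ fun x hx => lt_of_lt_of_le (hτ1i.trans hτi) hx)
    intro x hx
    rw [interior_Ici] at hx
    exact hp''pos x (Or.inr hx)
  have hK : ∀ x, 1 < x → HasDerivAt
      (fun x => 2 * h x - 2 * h τ1i - q τ1i * (x ^ 2 - τ1i ^ 2)) (2 * x * (q x - q τ1i)) x := by
    intro x hx
    have := (((hh x hx).const_mul 2).sub_const (2 * h τ1i)).sub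
      ((((hasDerivAt_id x).pow 2).sub_const (τ1i ^ 2)).const_mul (q τ1i))
    refine this.congr_deriv ?_
    simp
    ring
  have hKc : 2 * h τc - 2 * h τ1i - q τ1i * (τc ^ 2 - τ1i ^ 2) = 0 := by
    have : τc ^ 2 - τ1i ^ 2 ≠ 0 := by nlinarith
    rw [hτceq]
    field_simp
    ring
  have hqc1 : q τ1i < q τc := by
    by_contra! hle
    have : StrictAntiOn (fun x => 2 * h x - 2 * h τ1i - q τ1i * (x ^ 2 - τ1i ^ 2))
        (Icc τ1i τc) := by
      apply strictAntiOn_of_deriv_neg (convex_Icc _ _)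
      · intro x hx
        exact (hK x (lt_of_lt_of_le hτ1i hx.1)).continuousAt.continuousWithinAt
      · intro x hx
        rw [interior_Icc] at hx
        have hx1 : 1 < x := hτ1i.trans hx.1
        rw [(hK x hx1).deriv]
        have : q x < q τ1i := by
          rcases le_or_gt x τ2i with h2 | h2
          · exact hqanti ⟨le_rfl, hτi.le⟩ ⟨hx.1.le, h2⟩ hx.1
          · exact (hqmono (mem_Ici.2 h2.le) (mem_Ici.2 (h2.trans hx.2).le) hx.2).trans_le hle
        exact mul_neg_of_pos_of_neg (by linarith) (by linarith)
    have := this ⟨le_rfl, hτc.le⟩ ⟨hτc.le, le_rfl⟩ hτc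
    simp only at this
    rw [hKc] at this
    simp at this
  have hc2 : τ2i < τc := by
    by_contra! hle
    exact absurd (hqanti ⟨le_rfl, hτi.le⟩ ⟨hτc.le, hle⟩ hτc) (by linarith)
  have hKf : 0 < 2 * h τf - 2 * h τ1i - q τ1i * (τf ^ 2 - τ1i ^ 2) := by
    have : StrictMonoOn (fun x => 2 * h x - 2 * h τ1i - q τ1i * (x ^ 2 - τ1i ^ 2))
        (Ici τc) := by
      apply strictMonoOn_of_deriv_pos (convex_Ici _)
      · intro x hx
        exact (hK x (lt_of_lt_of_le (hτ1i.trans hτc) hx)).continuousAt.continuousWithinAt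
      · intro x hx
        rw [interior_Ici] at hx
        have hx : τc < x := hx
        rw [(hK x (by linarith)).deriv]
        have := hqmono (mem_Ici.2 hc2.le) (mem_Ici.2 (hc2.trans hx).le) hx
        exact mul_pos (by linarith) (by linarith)
    have := this (mem_Ici.2 le_rfl) (mem_Ici.2 hτf.le) hτf
    simp only at this
    rwa [hKc] at this
  -- the sign function of the derivative of the chord slope
  let G : ℝ → ℝ := fun t => 2 * h τf - 2 * h t - q t * (τf ^ 2 - t ^ 2)
  have hG : ∀ x, 1 < x → HasDerivAt G (-(deriv q x * (τf ^ 2 - x ^ 2))) x := by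
    intro x hx
    have := (((hh x hx).const_mul 2).const_sub (2 * h τf)).sub
      ((hq x hx).mul (((hasDerivAt_id x).pow 2).const_sub (τf ^ 2)))
    refine this.congr_deriv ?_
    simp
    ring
  have hGc : ∀ s ⊆ Ioi (1:ℝ), ContinuousOn G s := fun s hs x hx =>
    (hG x (hs hx)).continuousAt.continuousWithinAt
  have hG1 : 0 < G τ1i := hKf
  have hGpos : ∀ x, 1 < x → x < τf → 0 < G x := by
    intro x hx hxf
    rcases lt_trichotomy x τ1i with hlt | heq | hgt
    · have : StrictAntiOn G (Icc x τ1i) := by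
        apply strictAntiOn_of_deriv_neg (convex_Icc _ _)
          (hGc _ fun y hy => lt_of_lt_of_le hx hy.1)
        intro y hy
        rw [interior_Icc] at hy
        have hy1 : 1 < y := hx.trans hy.1
        rw [(hG y hy1).deriv]
        have h1 := hp''pos y (Or.inl ⟨hy1, hy.2⟩)
        have h2 : 0 < τf ^ 2 - y ^ 2 := by nlinarith [hy.2]
        linarith [mul_pos h1 h2]
      exact hG1.trans (this ⟨le_rfl, hlt.le⟩ ⟨hlt.le, le_rfl⟩ hlt)
    · rw [heq]; exact hG1
    rcases le_or_gt x τ2i with h2 | h2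
    · have : StrictMonoOn G (Icc τ1i x) := by
        apply strictMonoOn_of_deriv_pos (convex_Icc _ _)
          (hGc _ fun y hy => lt_of_lt_of_le hτ1i hy.1)
        intro y hy
        rw [interior_Icc] at hy
        have hy1 : 1 < y := hτ1i.trans hy.1
        rw [(hG y hy1).deriv]
        have h1 := hp''neg y hy.1 (hy.2.trans_le h2)
        have h2 : 0 < τf ^ 2 - y ^ 2 := by nlinarith [hy.2]
        linarith [mul_neg_of_neg_of_pos h1 h2]
      exact hG1.trans (this ⟨le_rfl, hgt.le⟩ ⟨hgt.le, le_rfl⟩ hgt)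
    · have : StrictAntiOn G (Icc x τf) := by
        apply strictAntiOn_of_deriv_neg (convex_Icc _ _)
          (hGc _ fun y hy => lt_of_lt_of_le hx hy.1)
        intro y hy
        rw [interior_Icc] at hy
        have hy1 : 1 < y := hx.trans hy.1
        rw [(hG y hy1).deriv]
        have h1 := hp''pos y (Or.inr (h2.trans hy.1))
        have h2 : 0 < τf ^ 2 - y ^ 2 := by nlinarith [hy.2]
        linarith [mul_pos h1 h2]
      have := this ⟨le_rfl, hxf.le⟩ ⟨hxf.le, le_rfl⟩ hxf
      have h0 : G τf = 0 := by simp [G]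
      linarith
  have hF : ∀ x, 1 < x → x < τf → HasDerivAt
      (fun t => (2 * h τf - 2 * h t) / (τf ^ 2 - t ^ 2))
      (2 * x * G x / (τf ^ 2 - x ^ 2) ^ 2) x := by
    intro x hx hxf
    have hne : τf ^ 2 - x ^ 2 ≠ 0 := by nlinarith
    have hd : HasDerivAt (fun t : ℝ => τf ^ 2 - t ^ 2) (-(2 * x)) x := by
      simpa using (hasDerivAt_pow 2 x).const_sub (τf ^ 2)
    have := (((hh x hx).const_mul 2).const_sub (2 * h τf)).div hd hne
    refine this.congr_deriv ?_
    simp only [G]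
    congr 1
    ring
  have hmono : StrictMonoOn (fun t => (2 * h τf - 2 * h t) / (τf ^ 2 - t ^ 2)) (Ioo 1 τf) := by
    apply strictMonoOn_of_deriv_pos (convex_Ioo _ _)
    · intro x hx
      exact (hF x hx.1 hx.2).continuousAt.continuousWithinAt
    · intro x hx
      rw [interior_Ioo] at hx
      rw [(hF x hx.1 hx.2).deriv]
      have h1 := hGpos x hx.1 hx.2
      have h2 : 0 < τf ^ 2 - x ^ 2 := by nlinarith [hx.1, hx.2]
      have h3 : 0 < x := by linarith [hx.1]
      positivity
  intro τb hb τ ht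
  exact hmono hb ⟨hb.1.trans ht.1, ht.2⟩ ht.1
end

section
/- (Post-sonic shock.) For every τ_f ∈ (τ₂ⁱ, τ_c) there exists a unique τ_po ∈ (τ₁ⁱ, τ₂ⁱ) such that p′(τ_po) = (2h(τ_po)−2h(τ_f))/(τ_po²−τ_f²); moreover this common value is strictly less than p′(τ_f). -/
open Real Set

/-- (Post-sonic shock.) For every `τ_f ∈ (τ₂ⁱ, τ_c)` there exists a unique
`τ_po ∈ (τ₁ⁱ, τ₂ⁱ)` with `p'(τ_po) = (2h(τ_po)−2h(τ_f))/(τ_po²−τ_f²)`;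
moreover this common value is strictly less than `p'(τ_f)`. -/
theorem stmt4
    (γ S : ℝ) (hγ1 : 1 < γ) (hγ2 : γ < 2) (hS : 0 < S)
    (p : ℝ → ℝ) (hpdef : ∀ τ : ℝ, p τ = S / (τ - 1) ^ γ - 1 / τ ^ 2)
    (τ1i τ2i : ℝ) (hτ1i : 1 < τ1i) (hτi : τ1i < τ2i)
    (hp' : ∀ τ : ℝ, 1 < τ → deriv p τ < 0)
    (hp''pos : ∀ τ : ℝ, (1 < τ ∧ τ < τ1i) ∨ τ2i < τ → 0 < deriv (deriv p) τ)
    (hp''neg : ∀ τ : ℝ, τ1i < τ → τ < τ2i → deriv (deriv p) τ < 0)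
    (h : ℝ → ℝ)
    (hh : ∀ τ : ℝ, 1 < τ → HasDerivAt h (τ * deriv p τ) τ)
    (τc : ℝ) (hτc : τ1i < τc)
    (hτceq : deriv p τ1i = (2 * h τc - 2 * h τ1i) / (τc ^ 2 - τ1i ^ 2))
    (τf : ℝ) (hτf : τf ∈ Ioo τ2i τc) :
    ∃ b : ℝ,
      (b ∈ Ioo τ1i τ2i ∧
        deriv p b = (2 * h b - 2 * h τf) / (b ^ 2 - τf ^ 2)) ∧
      (∀ b' : ℝ, (b' ∈ Ioo τ1i τ2i ∧
        deriv p b' = (2 * h b' - 2 * h τf) / (b' ^ 2 - τf ^ 2)) → b' = b) ∧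
      deriv p b < deriv p τf := by
  have hpfun : p = fun τ : ℝ => S / (τ - 1) ^ γ - 1 / τ ^ 2 := funext hpdef
  have hsm : ∀ τ : ℝ, 1 < τ → ContDiffAt ℝ 2 p τ := by
    intro τ hτ
    rw [hpfun]
    have h1 : τ - 1 ≠ 0 := by linarith
    have h2 : (τ - 1) ^ γ ≠ 0 := (Real.rpow_pos_of_pos (by linarith) γ).ne'
    have h3 : τ ^ 2 ≠ 0 := by positivity
    have h4 : ContDiffAt ℝ 2 (fun τ : ℝ => (τ - 1) ^ γ) τ :=
      ContDiffAt.rpow_const_of_ne (contDiffAt_id.sub contDiffAt_const) h1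
    exact (contDiffAt_const.div h4 h2).sub
      (contDiffAt_const.div (contDiffAt_id.pow 2) h3)
  have hqd : ∀ τ : ℝ, 1 < τ → DifferentiableAt ℝ (deriv p) τ := by
    intro τ hτ
    have h1 : ContDiffAt ℝ 1 (fderiv ℝ p) τ :=
      (hsm τ hτ).fderiv_right (m := 1) (by norm_num)
    have h2 : DifferentiableAt ℝ (fun x => fderiv ℝ p x 1) τ :=
      (h1.differentiableAt (by norm_num)).clm_apply (differentiableAt_const 1)
    exact h2
  generalize hq : deriv p = q at *
  obtain ⟨hf1, hf2⟩ := hτf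
  have hqc : ∀ a b : ℝ, 1 < a → ContinuousOn q (Icc a b) := fun a b ha x hx =>
    (hqd x (by linarith [hx.1])).continuousAt.continuousWithinAt
  have hanti : StrictAntiOn q (Icc τ1i τ2i) := by
    apply strictAntiOn_of_deriv_neg (convex_Icc _ _) (hqc _ _ hτ1i)
    intro x hx
    rw [interior_Icc] at hx
    exact hp''neg x hx.1 hx.2
  have hmono : StrictMonoOn q (Ici τ2i) := by
    apply strictMonoOn_of_deriv_pos (convex_Ici _)
    · intro x hx
      exact (hqd x (by linarith [mem_Ici.1 hx])).continuousAt.continuousWithinAt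
    intro x hx
    rw [interior_Ici] at hx
    exact hp''pos x (Or.inr hx)
  have hK : ∀ b x : ℝ, 1 < x →
      HasDerivAt (fun x => 2 * h x - 2 * h b - q b * (x ^ 2 - b ^ 2))
        (2 * x * (q x - q b)) x := by
    intro b x hx
    have := ((((hh x hx).const_mul 2).sub_const (2 * h b)).sub
      ((((hasDerivAt_id x).pow 2).sub_const (b ^ 2)).const_mul (q b)))
    refine this.congr_deriv ?_
    simp
    ring
  have hF : ∀ x : ℝ, 1 < x →
      HasDerivAt (fun x => 2 * h τf - 2 * h x - q x * (τf ^ 2 - x ^ 2))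
        (- (deriv q x * (τf ^ 2 - x ^ 2))) x := by
    intro x hx
    have := ((((hh x hx).const_mul 2).const_sub (2 * h τf)).sub
      ((hqd x hx).hasDerivAt.mul (((hasDerivAt_id x).pow 2).const_sub (τf ^ 2))))
    refine this.congr_deriv ?_
    simp
    ring
  -- sign facts
  have mvt : ∀ b u v : ℝ, 1 < u → u < v → ∃ ξ ∈ Ioo u v,
      2 * ξ * (q ξ - q b) * (v - u) =
      (2 * h v - 2 * h b - q b * (v ^ 2 - b ^ 2))
        - (2 * h u - 2 * h b - q b * (u ^ 2 - b ^ 2)) := by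
    intro b u v hu huv
    obtain ⟨ξ, hξ, e⟩ := exists_hasDerivAt_eq_slope _ _ huv
      (fun x hx => (hK b x (by linarith [hx.1])).continuousAt.continuousWithinAt)
      (fun x hx => hK b x (by linarith [hx.1]))
    refine ⟨ξ, hξ, ?_⟩
    have : v - u ≠ 0 := by linarith
    rw [e]
    field_simp
  have key : ∀ b v : ℝ, τ1i ≤ b → b < τ2i → τ2i < v →
      0 ≤ 2 * h v - 2 * h b - q b * (v ^ 2 - b ^ 2) → q b < q v := by
    intro b v hb1 hb2 hv h0
    obtain ⟨ξ, hξ, e⟩ := mvt b b τ2i (by linarith) hb2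
    obtain ⟨η, hη, e'⟩ := mvt b τ2i v (by linarith) hv
    have l1 : q ξ < q b :=
      hanti ⟨hb1, hb2.le⟩ ⟨by linarith [hξ.1], hξ.2.le⟩ hξ.1
    have l2 : 2 * ξ * (q ξ - q b) * (τ2i - b) < 0 := by
      have : 0 < 2 * ξ * (q b - q ξ) * (τ2i - b) :=
        mul_pos (mul_pos (by linarith [hξ.1]) (by linarith)) (by linarith)
      linarith
    have l3 : 0 < 2 * η * (q η - q b) * (v - τ2i) := by linarith
    have l4 : 0 < 2 * η * (q η - q b) := pos_of_mul_pos_left l3 (by linarith)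
    have l5 : 0 < q η - q b := pos_of_mul_pos_right l4 (by linarith [hη.1])
    have l6 : q η < q v := hmono hη.1.le hv.le hη.2
    linarith
  have hend2 : 0 < 2 * h τf - 2 * h τ2i - q τ2i * (τf ^ 2 - τ2i ^ 2) := by
    obtain ⟨ξ, hξ, e⟩ := mvt τ2i τ2i τf (by linarith) hf1
    have l1 : q τ2i < q ξ := hmono self_mem_Ici hξ.1.le hξ.1
    have : 0 < 2 * ξ * (q ξ - q τ2i) * (τf - τ2i) :=
      mul_pos (mul_pos (by linarith [hξ.1]) (by linarith)) (by linarith)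
    linarith
  have hend1 : 2 * h τf - 2 * h τ1i - q τ1i * (τf ^ 2 - τ1i ^ 2) < 0 := by
    by_contra! h0
    have l0 := key τ1i τf le_rfl hτi hf1 h0
    obtain ⟨ξ, hξ, e⟩ := mvt τ1i τf τc (by linarith) hf2
    have l1 : q τf < q ξ := hmono hf1.le (by simp; linarith [hξ.1]) hξ.1
    have : 0 < 2 * ξ * (q ξ - q τ1i) * (τc - τf) :=
      mul_pos (mul_pos (by linarith [hξ.1]) (by linarith)) (by linarith)
    have hne : τc ^ 2 - τ1i ^ 2 ≠ 0 := by nlinarith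
    rw [eq_div_iff hne] at hτceq
    linarith
  have hFc : ContinuousOn (fun x => 2 * h τf - 2 * h x - q x * (τf ^ 2 - x ^ 2))
      (Icc τ1i τ2i) := fun x hx =>
    (hF x (by linarith [hx.1])).continuousAt.continuousWithinAt
  have hFm : StrictMonoOn (fun x => 2 * h τf - 2 * h x - q x * (τf ^ 2 - x ^ 2))
      (Icc τ1i τ2i) := by
    apply strictMonoOn_of_deriv_pos (convex_Icc _ _) hFc
    intro x hx
    rw [interior_Icc] at hx
    rw [(hF x (by linarith [hx.1])).deriv]
    have l1 := hp''neg x hx.1 hx.2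
    have l2 : 0 < τf ^ 2 - x ^ 2 := by nlinarith [hx.1, hx.2]
    nlinarith
  have hiff : ∀ b ∈ Ioo τ1i τ2i, (q b = (2 * h b - 2 * h τf) / (b ^ 2 - τf ^ 2) ↔
      2 * h τf - 2 * h b - q b * (τf ^ 2 - b ^ 2) = 0) := by
    intro b hb
    have hne : b ^ 2 - τf ^ 2 ≠ 0 := by
      have : 0 < τf ^ 2 - b ^ 2 := by nlinarith [hb.1, hb.2]
      linarith
    rw [eq_div_iff hne]
    constructor <;> intro <;> linarith
  obtain ⟨b, hb, hb0⟩ := intermediate_value_Ioo hτi.le hFc ⟨hend1, hend2⟩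
  refine ⟨b, ⟨hb, (hiff b hb).2 hb0⟩, ?_, ?_⟩
  · rintro b' ⟨hb', e⟩
    exact hFm.injOn (Ioo_subset_Icc_self hb') (Ioo_subset_Icc_self hb)
      (((hiff b' hb').1 e).trans hb0.symm)
  · exact key b τf hb.1.le hb.2 hf1 hb0.ge
end

section
/- For every τ_f ∈ (τ₂ⁱ, τ_c), the pair (τ_po(τ_f), τ_f) satisfies Liu's extended entropy condition: (2h(τ_f)−2h(τ_po(τ_f)))/(τ_f²−τ_po(τ_f)²) < (2h(τ_f)−2h(τ))/(τ_f²−τ²) for all τ ∈ (τ_po(τ_f), τ_f). -/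
open Real Set

/-- For every `τ_f ∈ (τ₂ⁱ, τ_c)`, the pair `(τ_po(τ_f), τ_f)` satisfies Liu's
extended entropy condition. -/
theorem stmt5
    (γ S : ℝ) (hγ1 : 1 < γ) (hγ2 : γ < 2) (hS : 0 < S)
    (p : ℝ → ℝ) (hpdef : ∀ τ : ℝ, p τ = S / (τ - 1) ^ γ - 1 / τ ^ 2)
    (τ1i τ2i : ℝ) (hτ1i : 1 < τ1i) (hτi : τ1i < τ2i)
    (hp' : ∀ τ : ℝ, 1 < τ → deriv p τ < 0)
    (hp''pos : ∀ τ : ℝ, (1 < τ ∧ τ < τ1i) ∨ τ2i < τ → 0 < deriv (deriv p) τ)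
    (hp''neg : ∀ τ : ℝ, τ1i < τ → τ < τ2i → deriv (deriv p) τ < 0)
    (h : ℝ → ℝ)
    (hh : ∀ τ : ℝ, 1 < τ → HasDerivAt h (τ * deriv p τ) τ)
    (τc : ℝ) (hτc : τ1i < τc)
    (hτceq : deriv p τ1i = (2 * h τc - 2 * h τ1i) / (τc ^ 2 - τ1i ^ 2))
    (τpo : ℝ → ℝ)
    (hτpo : ∀ τf ∈ Set.Ioo τ2i τc, τpo τf ∈ Set.Ioo τ1i τ2i ∧
      deriv p (τpo τf) = (2 * h (τpo τf) - 2 * h τf) / ((τpo τf) ^ 2 - τf ^ 2))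
    (τf : ℝ) (hτf : τf ∈ Ioo τ2i τc) :
    ∀ τ ∈ Ioo (τpo τf) τf,
      (2 * h τf - 2 * h (τpo τf)) / (τf ^ 2 - (τpo τf) ^ 2) <
        (2 * h τf - 2 * h τ) / (τf ^ 2 - τ ^ 2) := by
  obtain ⟨⟨ha1, ha2⟩, heq⟩ := hτpo τf hτf
  obtain ⟨hf2, hfc⟩ := hτf
  generalize τpo τf = a at *
  have hanti : StrictAntiOn (deriv p) (Ico a τ2i) := by
    apply strictAntiOn_of_deriv_neg (convex_Ico a τ2i)
    · intro x hx
      exact (differentiableAt_of_deriv_ne_zero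
        (hp''neg x (by linarith [hx.1]) hx.2).ne).continuousAt.continuousWithinAt
    · intro x hx
      rw [interior_Ico] at hx
      exact hp''neg x (by linarith [hx.1]) hx.2
  have hmono : StrictMonoOn (deriv p) (Ioi τ2i) := by
    apply strictMonoOn_of_deriv_pos (convex_Ioi τ2i)
    · intro x hx
      exact (differentiableAt_of_deriv_ne_zero
        (hp''pos x (Or.inr hx)).ne').continuousAt.continuousWithinAt
    · intro x hx
      rw [interior_Ioi] at hx
      exact hp''pos x (Or.inr hx)
  obtain ⟨s, hs⟩ : ∃ s, s = deriv p a := ⟨_, rfl⟩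
  obtain ⟨F, hF⟩ : ∃ F : ℝ → ℝ, F = fun t => 2 * h t - s * t ^ 2 := ⟨_, rfl⟩
  have hder : ∀ t, 1 < t → HasDerivAt F (2 * t * (deriv p t - s)) t := by
    intro t ht
    rw [hF]
    have h1 := ((hh t ht).const_mul 2).sub (((hasDerivAt_id t).pow 2).const_mul s)
    refine h1.congr_deriv ?_
    simp
    ring
  have hcont : ∀ u v, 1 < u → ContinuousOn F (Icc u v) := fun u v hu x hx =>
    (hder x (by linarith [hx.1])).continuousAt.continuousWithinAt
  have hFanti : StrictAntiOn F (Icc a τ2i) := by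
    apply strictAntiOn_of_deriv_neg (convex_Icc a τ2i) (hcont _ _ (by linarith))
    intro x hx
    rw [interior_Icc] at hx
    rw [(hder x (by linarith [hx.1])).deriv]
    have := hanti ⟨le_refl a, ha2⟩ ⟨hx.1.le, hx.2⟩ hx.1
    exact mul_neg_of_pos_of_neg (by linarith [hx.1]) (by linarith)
  have hne : a ^ 2 - τf ^ 2 < 0 := by nlinarith
  have hFeq : F a = F τf := by
    rw [← hs, eq_div_iff hne.ne] at heq
    rw [hF]
    simp only
    linarith
  intro τ hτ
  have hkey : F τ < F τf := by
    rw [← hFeq]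
    rcases le_or_gt τ τ2i with hle | hgt
    · exact hFanti ⟨le_refl a, ha2.le⟩ ⟨hτ.1.le, hle⟩ hτ.1
    · by_contra hcon
      push Not at hcon
      have h2 : F τ2i < F a := hFanti ⟨le_refl a, ha2.le⟩ ⟨ha2.le, le_refl _⟩ ha2
      obtain ⟨c, hc, hceq⟩ := exists_hasDerivAt_eq_slope F
        (fun t => 2 * t * (deriv p t - s)) hgt (hcont _ _ (by linarith))
        (fun x hx => hder x (by linarith [hx.1]))
      have hpos : 0 < 2 * c * (deriv p c - s) := by
        rw [hceq]
        exact div_pos (by linarith) (by linarith)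
      have hc0 : 0 < 2 * c := by linarith [hc.1]
      have hcs : 0 < deriv p c - s := (mul_pos_iff_of_pos_left hc0).1 hpos
      have hFm : StrictMonoOn F (Icc τ τf) := by
        apply strictMonoOn_of_deriv_pos (convex_Icc τ τf) (hcont _ _ (by linarith))
        intro x hx
        rw [interior_Icc] at hx
        rw [(hder x (by linarith [hx.1])).deriv]
        have := hmono (show c ∈ Ioi τ2i from hc.1)
          (show x ∈ Ioi τ2i from hgt.trans hx.1) (hc.2.trans hx.1)
        exact mul_pos (by linarith [hx.1]) (by linarith)
      have := hFm ⟨le_refl _, hτ.2.le⟩ ⟨hτ.2.le, le_refl _⟩ hτ.2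
      linarith
  have hL : (2 * h τf - 2 * h a) / (τf ^ 2 - a ^ 2) = s := by
    rw [div_eq_iff (by linarith)]
    rw [hF] at hFeq
    simp only at hFeq
    linarith
  rw [hL, lt_div_iff₀ (by nlinarith [hτ.1, hτ.2])]
  rw [hF] at hkey
  simp only at hkey
  linarith
end

section
/- The function τ_f ↦ τ_po(τ_f) is strictly decreasing on (τ₂ⁱ, τ_c): if τ₂ⁱ < τ_f < τ̃_f < τ_c then τ_po(τ̃_f) < τ_po(τ_f). -/
open Real Set

/-- The function `τ_f ↦ τ_po(τ_f)` is strictly decreasing on `(τ₂ⁱ, τ_c)`. -/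
theorem stmt6
    (γ S : ℝ) (hγ1 : 1 < γ) (hγ2 : γ < 2) (hS : 0 < S)
    (p : ℝ → ℝ) (hpdef : ∀ τ : ℝ, p τ = S / (τ - 1) ^ γ - 1 / τ ^ 2)
    (τ1i τ2i : ℝ) (hτ1i : 1 < τ1i) (hτi : τ1i < τ2i)
    (hp' : ∀ τ : ℝ, 1 < τ → deriv p τ < 0)
    (hp''pos : ∀ τ : ℝ, (1 < τ ∧ τ < τ1i) ∨ τ2i < τ → 0 < deriv (deriv p) τ)
    (hp''neg : ∀ τ : ℝ, τ1i < τ → τ < τ2i → deriv (deriv p) τ < 0)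
    (h : ℝ → ℝ)
    (hh : ∀ τ : ℝ, 1 < τ → HasDerivAt h (τ * deriv p τ) τ)
    (τc : ℝ) (hτc : τ1i < τc)
    (hτceq : deriv p τ1i = (2 * h τc - 2 * h τ1i) / (τc ^ 2 - τ1i ^ 2))
    (τpo : ℝ → ℝ)
    (hτpo : ∀ τf ∈ Set.Ioo τ2i τc, τpo τf ∈ Set.Ioo τ1i τ2i ∧
      deriv p (τpo τf) = (2 * h (τpo τf) - 2 * h τf) / ((τpo τf) ^ 2 - τf ^ 2)) :
    ∀ τf τf' : ℝ, τ2i < τf → τf < τf' → τf' < τc → τpo τf' < τpo τf := by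
  intro f f' hf2 hff' hfc
  have hcont : ContinuousOn (deriv p) (Ioi 1) := by
    have hp : p = fun τ => S / (τ - 1) ^ γ - 1 / τ ^ 2 := funext hpdef
    have hC : ContDiffOn ℝ 2 p (Ioi 1) := by
      rw [hp]
      intro x hx
      have hx1 : (1 : ℝ) < x := hx
      apply ContDiffAt.contDiffWithinAt
      have h1 : x - 1 ≠ 0 := by linarith
      have h2 : (x - 1) ^ γ ≠ 0 := (Real.rpow_pos_of_pos (by linarith) γ).ne'
      have h3 : x ^ 2 ≠ 0 := by positivity
      apply ContDiffAt.sub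
      · exact contDiffAt_const.div
          ((contDiffAt_id.sub contDiffAt_const).rpow_const_of_ne h1) h2
      · exact contDiffAt_const.div (contDiffAt_id.pow 2) h3
    exact hC.continuousOn_deriv_of_isOpen isOpen_Ioi (by norm_num)
  obtain ⟨⟨ha1, ha2⟩, haeq⟩ := hτpo f ⟨hf2, by linarith⟩
  obtain ⟨⟨hb1, hb2⟩, hbeq⟩ := hτpo f' ⟨by linarith, hfc⟩
  generalize τpo f = a at *
  generalize τpo f' = b at *
  rw [eq_div_iff (by nlinarith)] at haeq hbeq
  by_contra hab
  push Not at hab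
  have hanti : StrictAntiOn (deriv p) (Icc a τ2i) := by
    apply strictAntiOn_of_deriv_neg (convex_Icc _ _)
    · exact hcont.mono fun x hx => show (1 : ℝ) < x by linarith [hx.1]
    · intro x hx
      rw [interior_Icc] at hx
      exact hp''neg x (by linarith [hx.1]) hx.2
  have hmono : StrictMonoOn (deriv p) (Icc τ2i f') := by
    apply strictMonoOn_of_deriv_pos (convex_Icc _ _)
    · exact hcont.mono fun x hx => show (1 : ℝ) < x by linarith [hx.1]
    · intro x hx
      rw [interior_Icc] at hx
      exact hp''pos x (Or.inr hx.1)
  have hφ : ∀ x, 1 < x → HasDerivAt (fun t => deriv p a * t ^ 2 - 2 * h t)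
      (2 * x * (deriv p a - deriv p x)) x := by
    intro x hx
    have := ((hasDerivAt_pow 2 x).const_mul (deriv p a)).sub ((hh x hx).const_mul 2)
    refine this.congr_deriv ?_
    push_cast
    ring
  have hq : deriv p a < deriv p f := by
    by_contra hle
    push Not at hle
    have hm : StrictMonoOn (fun t => deriv p a * t ^ 2 - 2 * h t) (Icc a f) := by
      apply strictMonoOn_of_deriv_pos (convex_Icc _ _)
      · intro x hx
        exact (hφ x (by linarith [hx.1])).continuousAt.continuousWithinAt
      · intro x hx
        rw [interior_Icc] at hx
        have hx1 : 1 < x := by linarith [hx.1]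
        rw [(hφ x hx1).deriv]
        have : deriv p x < deriv p a := by
          rcases le_total x τ2i with hx2 | hx2
          · exact hanti ⟨le_rfl, ha2.le⟩ ⟨hx.1.le, hx2⟩ hx.1
          · exact (hmono ⟨hx2, by linarith [hx.2]⟩ ⟨hf2.le, hff'.le⟩ hx.2).trans_le hle
        exact mul_pos (by linarith) (by linarith)
    have := hm (left_mem_Icc.2 (by linarith)) (right_mem_Icc.2 (by linarith))
      (show a < f by linarith)
    simp only at this
    nlinarith
  have hlt : deriv p a * f' ^ 2 - 2 * h f' < deriv p a * f ^ 2 - 2 * h f := by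
    have hm : StrictAntiOn (fun t => deriv p a * t ^ 2 - 2 * h t) (Icc f f') := by
      apply strictAntiOn_of_deriv_neg (convex_Icc _ _)
      · intro x hx
        exact (hφ x (by linarith [hx.1])).continuousAt.continuousWithinAt
      · intro x hx
        rw [interior_Icc] at hx
        have hx1 : 1 < x := by linarith [hx.1]
        rw [(hφ x hx1).deriv]
        have : deriv p f < deriv p x :=
          hmono ⟨hf2.le, hff'.le⟩ ⟨by linarith [hx.1], hx.2.le⟩ hx.1
        exact mul_neg_of_pos_of_neg (by linarith) (by linarith)
    exact hm (left_mem_Icc.2 hff'.le) (right_mem_Icc.2 hff'.le) hff'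
  have hψ : ∀ x, τ1i < x → x < τ2i →
      HasDerivAt (fun t => deriv p t * (f' ^ 2 - t ^ 2) + 2 * h t)
      (deriv (deriv p) x * (f' ^ 2 - x ^ 2)) x := by
    intro x hx hx2
    have hd : DifferentiableAt ℝ (deriv p) x :=
      differentiableAt_of_deriv_ne_zero (hp''neg x hx hx2).ne
    have := (hd.hasDerivAt.mul ((hasDerivAt_pow 2 x).const_sub (f' ^ 2))).add
      ((hh x (by linarith)).const_mul 2)
    refine this.congr_deriv ?_
    push_cast
    ring
  have hm : StrictAntiOn (fun t => deriv p t * (f' ^ 2 - t ^ 2) + 2 * h t) (Icc a b) := by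
    apply strictAntiOn_of_deriv_neg (convex_Icc _ _)
    · intro x hx
      exact (hψ x (by linarith [hx.1]) (by linarith [hx.2])).continuousAt.continuousWithinAt
    · intro x hx
      rw [interior_Icc] at hx
      have hx1 : τ1i < x := by linarith [hx.1]
      have hx2 : x < τ2i := by linarith [hx.2]
      rw [(hψ x hx1 hx2).deriv]
      exact mul_neg_of_neg_of_pos (hp''neg x hx1 hx2) (by nlinarith)
  have := hm.antitoneOn (left_mem_Icc.2 hab) (right_mem_Icc.2 hab) hab
  nlinarith
end

section
/- Suppose τ_f ∈ (τ₂ⁱ, τ_c). Then for every τ_b ∈ (τ_po(τ_f), τ_f) one has p′(τ_b) < (2h(τ_b)−2h(τ_f))/(τ_b²−τ_f²) < p′(τ_f), and Liu's extended entropy condition holds for the pair (τ_b, τ_f): (2h(τ_f)−2h(τ_b))/(τ_f²−τ_b²) < (2h(τ_f)−2h(τ))/(τ_f²−τ²) for all τ ∈ (τ_b, τ_f). -/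
open Real Set

/-- Suppose `τ_f ∈ (τ₂ⁱ, τ_c)`. Then for every `τ_b ∈ (τ_po(τ_f), τ_f)` one has
`p'(τ_b) < (2h(τ_b)−2h(τ_f))/(τ_b²−τ_f²) < p'(τ_f)` and Liu's extended entropy
condition holds for `(τ_b, τ_f)`. -/
theorem stmt7
    (γ S : ℝ) (hγ1 : 1 < γ) (hγ2 : γ < 2) (hS : 0 < S)
    (p : ℝ → ℝ) (hpdef : ∀ τ : ℝ, p τ = S / (τ - 1) ^ γ - 1 / τ ^ 2)
    (τ1i τ2i : ℝ) (hτ1i : 1 < τ1i) (hτi : τ1i < τ2i)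
    (hp' : ∀ τ : ℝ, 1 < τ → deriv p τ < 0)
    (hp''pos : ∀ τ : ℝ, (1 < τ ∧ τ < τ1i) ∨ τ2i < τ → 0 < deriv (deriv p) τ)
    (hp''neg : ∀ τ : ℝ, τ1i < τ → τ < τ2i → deriv (deriv p) τ < 0)
    (h : ℝ → ℝ)
    (hh : ∀ τ : ℝ, 1 < τ → HasDerivAt h (τ * deriv p τ) τ)
    (τc : ℝ) (hτc : τ1i < τc)
    (hτceq : deriv p τ1i = (2 * h τc - 2 * h τ1i) / (τc ^ 2 - τ1i ^ 2))
    (τpo : ℝ → ℝ)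
    (hτpo : ∀ τf ∈ Set.Ioo τ2i τc, τpo τf ∈ Set.Ioo τ1i τ2i ∧
      deriv p (τpo τf) = (2 * h (τpo τf) - 2 * h τf) / ((τpo τf) ^ 2 - τf ^ 2))
    (τf : ℝ) (hτf : τf ∈ Ioo τ2i τc) :
    ∀ τb ∈ Ioo (τpo τf) τf,
      (deriv p τb < (2 * h τb - 2 * h τf) / (τb ^ 2 - τf ^ 2) ∧
       (2 * h τb - 2 * h τf) / (τb ^ 2 - τf ^ 2) < deriv p τf) ∧
      ∀ τ ∈ Ioo τb τf,
        (2 * h τf - 2 * h τb) / (τf ^ 2 - τb ^ 2) <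
          (2 * h τf - 2 * h τ) / (τf ^ 2 - τ ^ 2) := by
  obtain ⟨⟨ha1, ha2⟩, hpo⟩ := hτpo τf hτf
  obtain ⟨hf2, -⟩ := hτf
  set a := τpo τf with ha
  -- smoothness of `p`
  have hdiff : ∀ τ : ℝ, 1 < τ → HasDerivAt (deriv p) (deriv (deriv p) τ) τ := by
    intro τ hτ
    have hp : p = fun τ : ℝ => S / (τ - 1) ^ γ - 1 / τ ^ 2 := funext hpdef
    have h1 : AnalyticAt ℝ p τ := by
      rw [hp]
      have e1 : AnalyticAt ℝ (fun τ : ℝ => (τ - 1) ^ γ) τ :=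
        ((contDiffAt_id.sub contDiffAt_const).rpow_const_of_ne
          (show τ - 1 ≠ 0 from (sub_pos.2 hτ).ne')).analyticAt
      have e2 : AnalyticAt ℝ (fun τ : ℝ => τ ^ 2) τ := analyticAt_id.pow 2
      refine (analyticAt_const.div e1 ?_).sub (analyticAt_const.div e2 ?_)
      · exact (Real.rpow_pos_of_pos (by linarith) _).ne'
      · positivity
    exact h1.deriv.differentiableAt.hasDerivAt
  have hF : ∀ τ : ℝ, 1 < τ →
      HasDerivAt (fun x => deriv p x * (x ^ 2 - τf ^ 2) - (2 * h x - 2 * h τf))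
        (deriv (deriv p) τ * (τ ^ 2 - τf ^ 2)) τ := by
    intro τ hτ
    have e := ((hdiff τ hτ).mul (((hasDerivAt_id τ).pow 2).sub_const (τf ^ 2))).sub
      (((hh τ hτ).const_mul 2).sub_const (2 * h τf))
    refine e.congr_deriv ?_
    simp
    ring
  have hFm1 : StrictMonoOn (fun x => deriv p x * (x ^ 2 - τf ^ 2) - (2 * h x - 2 * h τf))
      (Icc a τ2i) := by
    apply strictMonoOn_of_deriv_pos (convex_Icc _ _)
    · intro x hx
      exact (hF x (by linarith [hx.1])).continuousAt.continuousWithinAt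
    · intro x hx
      rw [interior_Icc] at hx
      rw [(hF x (by linarith [hx.1])).deriv]
      have := hp''neg x (by linarith [hx.1]) hx.2
      exact mul_pos_of_neg_of_neg this (by nlinarith [hx.1, hx.2])
  have hFm2 : StrictAntiOn (fun x => deriv p x * (x ^ 2 - τf ^ 2) - (2 * h x - 2 * h τf))
      (Icc τ2i τf) := by
    apply strictAntiOn_of_deriv_neg (convex_Icc _ _)
    · intro x hx
      exact (hF x (by linarith [hx.1])).continuousAt.continuousWithinAt
    · intro x hx
      rw [interior_Icc] at hx
      rw [(hF x (by linarith [hx.1])).deriv]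
      have := hp''pos x (Or.inr hx.1)
      exact mul_neg_of_pos_of_neg this (by nlinarith [hx.1, hx.2])
  have hne : ∀ x, a < x → x < τf → x ^ 2 - τf ^ 2 < 0 := by
    intro x h1 h2
    nlinarith
  have hFpos : ∀ x, a < x → x < τf →
      0 < deriv p x * (x ^ 2 - τf ^ 2) - (2 * h x - 2 * h τf) := by
    intro x h1 h2
    rcases le_total x τ2i with h3 | h3
    · have := hFm1 ⟨le_rfl, ha2.le⟩ ⟨h1.le, h3⟩ h1
      have h0 : a ^ 2 - τf ^ 2 ≠ 0 := by
        have : a ^ 2 - τf ^ 2 < 0 := by nlinarith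
        exact this.ne
      rw [eq_div_iff h0] at hpo
      simp only at this
      linarith
    · have := hFm2 ⟨h3, h2.le⟩ ⟨hf2.le, le_rfl⟩ h2
      simp only at this
      linarith
  have hR : StrictMonoOn (fun x => (2 * h x - 2 * h τf) / (x ^ 2 - τf ^ 2)) (Ioo a τf) := by
    have hd : ∀ x ∈ Ioo a τf,
        HasDerivAt (fun x => (2 * h x - 2 * h τf) / (x ^ 2 - τf ^ 2))
          (2 * x * (deriv p x * (x ^ 2 - τf ^ 2) - (2 * h x - 2 * h τf))
            / (x ^ 2 - τf ^ 2) ^ 2) x := by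
      intro x hx
      have e := (((hh x (by linarith [hx.1])).const_mul 2).sub_const (2 * h τf)).div
        (((hasDerivAt_id x).pow 2).sub_const (τf ^ 2)) (hne x hx.1 hx.2).ne
      refine e.congr_deriv ?_
      simp
      ring
    apply strictMonoOn_of_deriv_pos (convex_Ioo _ _)
    · intro x hx
      exact (hd x hx).continuousAt.continuousWithinAt
    · intro x hx
      rw [interior_Ioo] at hx
      rw [(hd x hx).deriv]
      have h1 := hFpos x hx.1 hx.2
      have h2 := hne x hx.1 hx.2
      have h3 : 0 < x := by linarith [hx.1]
      exact div_pos (by positivity) (by nlinarith)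
  have hpm : StrictMonoOn (deriv p) (Icc τ2i τf) := by
    apply strictMonoOn_of_deriv_pos (convex_Icc _ _)
    · intro x hx
      exact (hdiff x (by linarith [hx.1])).continuousAt.continuousWithinAt
    · intro x hx
      rw [interior_Icc] at hx
      exact hp''pos x (Or.inr hx.1)
  have hG : StrictAntiOn (fun x => 2 * h x - deriv p τf * x ^ 2) (Icc τ2i τf) := by
    have hd : ∀ x, 1 < x → HasDerivAt (fun x => 2 * h x - deriv p τf * x ^ 2)
        (2 * x * (deriv p x - deriv p τf)) x := by
      intro x hx
      have e := ((hh x hx).const_mul 2).sub (((hasDerivAt_id x).pow 2).const_mul (deriv p τf))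
      refine e.congr_deriv ?_
      simp
      ring
    apply strictAntiOn_of_deriv_neg (convex_Icc _ _)
    · intro x hx
      exact (hd x (by linarith [hx.1])).continuousAt.continuousWithinAt
    · intro x hx
      rw [interior_Icc] at hx
      rw [(hd x (by linarith [hx.1])).deriv]
      have h1 := hpm ⟨hx.1.le, hx.2.le⟩ ⟨hf2.le, le_rfl⟩ hx.2
      have h2 := hx.1
      exact mul_neg_of_pos_of_neg (by linarith) (by linarith)
  have hR2 : ∀ x, τ2i ≤ x → x < τf →
      (2 * h x - 2 * h τf) / (x ^ 2 - τf ^ 2) < deriv p τf := by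
    intro x h1 h2
    rw [div_lt_iff_of_neg (hne x (by linarith) h2)]
    have := hG ⟨h1, h2.le⟩ ⟨hf2.le, le_rfl⟩ h2
    simp only at this
    linarith
  intro τb hb
  refine ⟨⟨?_, ?_⟩, ?_⟩
  · rw [lt_div_iff_of_neg (hne τb hb.1 hb.2)]
    linarith [hFpos τb hb.1 hb.2]
  · rcases le_or_gt τ2i τb with h3 | h3
    · exact hR2 τb h3 hb.2
    · exact (hR hb ⟨ha2, hf2⟩ h3).trans (hR2 τ2i le_rfl hf2)
  · intro τ hτ
    have := hR hb ⟨hb.1.trans hτ.1, hτ.2⟩ hτ.1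
    simp only at this
    rw [← neg_sub (2 * h τb), ← neg_sub (τb ^ 2), neg_div_neg_eq,
      ← neg_sub (2 * h τ), ← neg_sub (τ ^ 2), neg_div_neg_eq]
    exact this
end

section
/- (Pre-sonic shock.) For every τ_f ∈ (τ₁ⁱ, τ₂ⁱ) there exists a unique τ_pr ∈ (1, τ_f) such that (2h(τ_pr)−2h(τ_f))/(τ_pr²−τ_f²) = p′(τ_f); moreover τ_pr < τ₁ⁱ and p′(τ_pr) < p′(τ_f). -/
open Real Set

/-- (Pre-sonic shock.) For every `τ_f ∈ (τ₁ⁱ, τ₂ⁱ)` there exists a unique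
`τ_pr ∈ (1, τ_f)` with `(2h(τ_pr)−2h(τ_f))/(τ_pr²−τ_f²) = p'(τ_f)`;
moreover `τ_pr < τ₁ⁱ` and `p'(τ_pr) < p'(τ_f)`. -/
theorem stmt8
    (γ S : ℝ) (hγ1 : 1 < γ) (hγ2 : γ < 2) (hS : 0 < S)
    (p : ℝ → ℝ) (hpdef : ∀ τ : ℝ, p τ = S / (τ - 1) ^ γ - 1 / τ ^ 2)
    (τ1i τ2i : ℝ) (hτ1i : 1 < τ1i) (hτi : τ1i < τ2i)
    (hp' : ∀ τ : ℝ, 1 < τ → deriv p τ < 0)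
    (hp''pos : ∀ τ : ℝ, (1 < τ ∧ τ < τ1i) ∨ τ2i < τ → 0 < deriv (deriv p) τ)
    (hp''neg : ∀ τ : ℝ, τ1i < τ → τ < τ2i → deriv (deriv p) τ < 0)
    (h : ℝ → ℝ)
    (hh : ∀ τ : ℝ, 1 < τ → HasDerivAt h (τ * deriv p τ) τ)
    (τf : ℝ) (hτf : τf ∈ Ioo τ1i τ2i) :
    ∃ b : ℝ,
      (b ∈ Ioo 1 τf ∧
        (2 * h b - 2 * h τf) / (b ^ 2 - τf ^ 2) = deriv p τf) ∧
      (∀ b' : ℝ, (b' ∈ Ioo 1 τf ∧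
        (2 * h b' - 2 * h τf) / (b' ^ 2 - τf ^ 2) = deriv p τf) → b' = b) ∧
      b < τ1i ∧ deriv p b < deriv p τf := by
  obtain ⟨hf1, hf2⟩ := hτf
  have hf : 1 < τf := hτ1i.trans hf1
  have hpe : p = fun τ => S / (τ - 1) ^ γ - 1 / τ ^ 2 := funext hpdef
  have hcd : ContDiffOn ℝ 1 p (Ioi 1) := by
    rw [hpe]
    intro x hx
    have hx' : (1:ℝ) < x := hx
    have h1 : x - 1 ≠ 0 := by linarith
    have h2 : (x - 1) ^ γ ≠ 0 := (Real.rpow_pos_of_pos (by linarith) γ).ne'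
    have h3 : x ^ 2 ≠ 0 := by positivity
    apply ContDiffAt.contDiffWithinAt
    exact (contDiffAt_const.div
      ((contDiffAt_id.sub contDiffAt_const).rpow_const_of_ne h1) h2).sub
      (contDiffAt_const.div (contDiffAt_id.pow 2) h3)
  have hdc : ContinuousOn (deriv p) (Ioi 1) :=
    hcd.continuousOn_deriv_of_isOpen isOpen_Ioi le_rfl
  have hpd : ∀ x, 1 < x → DifferentiableAt ℝ p x := fun x hx =>
    (hcd.differentiableOn (by norm_num)).differentiableAt (isOpen_Ioi.mem_nhds hx)
  have hmono : StrictMonoOn (deriv p) (Ioc 1 τ1i) := by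
    apply strictMonoOn_of_deriv_pos (convex_Ioc _ _) (hdc.mono fun x hx => hx.1)
    intro x hx
    rw [interior_Ioc] at hx
    exact hp''pos x (Or.inl hx)
  have hanti : StrictAntiOn (deriv p) (Icc τ1i τf) := by
    apply strictAntiOn_of_deriv_neg (convex_Icc _ _)
      (hdc.mono fun x hx => lt_of_lt_of_le hτ1i hx.1)
    intro x hx
    rw [interior_Icc] at hx
    exact hp''neg x hx.1 (hx.2.trans hf2)
  obtain ⟨G, hG⟩ : ∃ G : ℝ → ℝ,
      G = fun x => 2 * h x - 2 * h τf - deriv p τf * (x ^ 2 - τf ^ 2) := ⟨_, rfl⟩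
  have hGd : ∀ x, 1 < x → HasDerivAt G (2 * x * (deriv p x - deriv p τf)) x := by
    intro x hx
    rw [hG]
    have := (((hh x hx).const_mul 2).sub_const (2 * h τf)).sub
      (((hasDerivAt_pow 2 x).sub_const (τf ^ 2)).const_mul (deriv p τf))
    refine HasDerivAt.congr_deriv this ?_
    norm_num
    ring
  have hGc : ContinuousOn G (Ioi 1) := fun x hx => (hGd x hx).continuousAt.continuousWithinAt
  have hGf : G τf = 0 := by rw [hG]; ring
  -- increasing where the slope exceeds that at τf
  have hinc : ∀ a b, 1 < a → a < b → (∀ x ∈ Ioo a b, deriv p τf < deriv p x) → G a < G b := by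
    intro a b ha hab hx
    have : StrictMonoOn G (Icc a b) := by
      apply strictMonoOn_of_deriv_pos (convex_Icc _ _)
        (hGc.mono fun x hx => lt_of_lt_of_le ha hx.1)
      intro x hxi
      rw [interior_Icc] at hxi
      have h1 : 1 < x := ha.trans hxi.1
      rw [(hGd x h1).deriv]
      exact mul_pos (by linarith) (sub_pos.2 (hx x hxi))
    exact this (left_mem_Icc.2 hab.le) (right_mem_Icc.2 hab.le) hab
  have hdec : ∀ a b, 1 < a → a < b → (∀ x ∈ Ioo a b, deriv p x < deriv p τf) → G b < G a := by
    intro a b ha hab hx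
    have : StrictAntiOn G (Icc a b) := by
      apply strictAntiOn_of_deriv_neg (convex_Icc _ _)
        (hGc.mono fun x hx => lt_of_lt_of_le ha hx.1)
      intro x hxi
      rw [interior_Icc] at hxi
      have h1 : 1 < x := ha.trans hxi.1
      rw [(hGd x h1).deriv]
      exact mul_neg_of_pos_of_neg (by linarith) (sub_neg.2 (hx x hxi))
    exact this (left_mem_Icc.2 hab.le) (right_mem_Icc.2 hab.le) hab
  have hright : ∀ a, τ1i ≤ a → a < τf → G a < 0 := by
    intro a ha haf
    rw [← hGf]
    apply hinc a τf (lt_of_lt_of_le hτ1i ha) haf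
    intro x hx
    exact hanti ⟨ha.trans hx.1.le, hx.2.le⟩ ⟨hf1.le, le_rfl⟩ hx.2
  have hslope : ∀ b, 1 < b → b < τ1i → G b = 0 → deriv p b < deriv p τf := by
    intro b hb hb1 hb0
    by_contra hcon
    push Not at hcon
    have := hinc b τ1i hb hb1 (fun x hx => lt_of_le_of_lt hcon
      (hmono ⟨hb, hb1.le⟩ ⟨hb.trans hx.1, hx.2.le⟩ hx.1))
    have := hright τ1i le_rfl hf1
    linarith
  have huniq : ∀ b b', 1 < b → b < b' → b' < τ1i → G b = 0 → G b' = 0 → False := by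
    intro b b' hb hbb hb1 h0 h0'
    have hs := hslope b' (hb.trans hbb) hb1 h0'
    have := hdec b b' hb hbb (fun x hx => lt_trans
      (hmono ⟨hb.trans hx.1, (hx.2.trans hb1).le⟩ ⟨hb.trans hbb, hb1.le⟩ hx.2) hs)
    linarith
  have hequiv : ∀ b, b ∈ Ioo 1 τf →
      ((2 * h b - 2 * h τf) / (b ^ 2 - τf ^ 2) = deriv p τf ↔ G b = 0) := by
    intro b hb
    have hne : b ^ 2 - τf ^ 2 ≠ 0 := by
      have := hb.1
      have := hb.2
      nlinarith
    rw [div_eq_iff hne, hG]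
    exact sub_eq_zero.symm
  -- blow-up of h at 1
  have hhp : AntitoneOn (fun x => h x - p x) (Ioi 1) := by
    have hd : ∀ x, 1 < x → HasDerivAt (fun x => h x - p x) (x * deriv p x - deriv p x) x :=
      fun x hx => (hh x hx).sub (hpd x hx).hasDerivAt
    apply antitoneOn_of_deriv_nonpos (convex_Ioi _)
      (fun x hx => (hd x hx).continuousAt.continuousWithinAt)
    · intro x hx
      rw [interior_Ioi] at hx
      exact (hd x hx).differentiableAt.differentiableWithinAt
    · intro x hx
      rw [interior_Ioi] at hx
      rw [(hd x hx).deriv]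
      have := hp' x hx
      have hx' : 1 < x := hx
      nlinarith
  have hex : ∀ M : ℝ, ∃ a, 1 < a ∧ a < τ1i ∧ M < p a := by
    intro M
    obtain ⟨e, he⟩ : ∃ e, e = min (min (1/2) ((τ1i - 1) / 2)) (S / (|M| + 2)) := ⟨_, rfl⟩
    have he0 : 0 < e := by
      rw [he]
      have : 0 < (τ1i - 1) / 2 := by linarith
      positivity
    have he1 : e ≤ 1/2 := by rw [he]; exact (min_le_left _ _).trans (min_le_left _ _)
    have he2 : e ≤ (τ1i - 1) / 2 := by rw [he]; exact (min_le_left _ _).trans (min_le_right _ _)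
    have he3 : e ≤ S / (|M| + 2) := by rw [he]; exact min_le_right _ _
    refine ⟨1 + e, by linarith, by linarith, ?_⟩
    rw [hpdef, add_sub_cancel_left]
    have hpow : e ^ γ ≤ e := by
      simpa using Real.rpow_le_rpow_of_exponent_ge he0 (by linarith : e ≤ 1) hγ1.le
    have hpp : 0 < e ^ γ := Real.rpow_pos_of_pos he0 γ
    have h1 : |M| + 2 ≤ S / e ^ γ := by
      rw [le_div_iff₀ (by positivity)] at he3
      rw [le_div_iff₀ hpp]
      have : 0 ≤ |M| := abs_nonneg M
      nlinarith
    have h2 : 1 / (1 + e) ^ 2 ≤ 1 := by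
      rw [div_le_one (by positivity)]
      nlinarith
    have := le_abs_self M
    linarith
  obtain ⟨a, ha1, ha2, hpa⟩ := hex (p τf - h τf + h τf - deriv p τf * τf ^ 2)
  have hGa : 0 < G a := by
    have h1 : h τf - p τf ≤ h a - p a := hhp ha1 hf (ha2.trans hf1).le
    have h2 := hp' τf hf
    have h3 : 0 ≤ a ^ 2 := sq_nonneg a
    have h4 : 0 ≤ τf ^ 2 := sq_nonneg τf
    have h5 : 0 ≤ -deriv p τf * a ^ 2 := by
      apply mul_nonneg <;> linarith
    have h6 : 0 ≤ -deriv p τf * τf ^ 2 := by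
      apply mul_nonneg <;> linarith
    rw [hG]
    show 0 < 2 * h a - 2 * h τf - deriv p τf * (a ^ 2 - τf ^ 2)
    linarith
  obtain ⟨b, hb, hGb⟩ : (0:ℝ) ∈ G '' Ioo a τ1i :=
    intermediate_value_Ioo' ha2.le (hGc.mono fun x hx => lt_of_lt_of_le ha1 hx.1)
      ⟨hright τ1i le_rfl hf1, hGa⟩
  have hb1 : 1 < b := ha1.trans hb.1
  have hbm : b ∈ Ioo 1 τf := ⟨hb1, hb.2.trans hf1⟩
  refine ⟨b, ⟨hbm, (hequiv b hbm).2 hGb⟩, ?_, hb.2, hslope b hb1 hb.2 hGb⟩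
  rintro c ⟨hc, hce⟩
  have hGC := (hequiv c hc).1 hce
  have hc1 : c < τ1i := by
    by_contra hcon
    have := hright c (not_lt.1 hcon) hc.2
    linarith
  rcases lt_trichotomy c b with hlt | heq | hgt
  · exact (huniq c b hc.1 hlt hb.2 hGC hGb).elim
  · exact heq
  · exact (huniq b c hb1 hgt hc1 hGb hGC).elim
end

section
/- For every τ_f ∈ (τ₁ⁱ, τ₂ⁱ), the pair (τ_pr(τ_f), τ_f) satisfies Liu's extended entropy condition: (2h(τ_f)−2h(τ_pr(τ_f)))/(τ_f²−τ_pr(τ_f)²) < (2h(τ_f)−2h(τ))/(τ_f²−τ²) for all τ ∈ (τ_pr(τ_f), τ_f). -/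
open Real Set

/-- For every `τ_f ∈ (τ₁ⁱ, τ₂ⁱ)`, the pair `(τ_pr(τ_f), τ_f)` satisfies Liu's
extended entropy condition. -/
theorem stmt9
    (γ S : ℝ) (hγ1 : 1 < γ) (hγ2 : γ < 2) (hS : 0 < S)
    (p : ℝ → ℝ) (hpdef : ∀ τ : ℝ, p τ = S / (τ - 1) ^ γ - 1 / τ ^ 2)
    (τ1i τ2i : ℝ) (hτ1i : 1 < τ1i) (hτi : τ1i < τ2i)
    (hp' : ∀ τ : ℝ, 1 < τ → deriv p τ < 0)
    (hp''pos : ∀ τ : ℝ, (1 < τ ∧ τ < τ1i) ∨ τ2i < τ → 0 < deriv (deriv p) τ)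
    (hp''neg : ∀ τ : ℝ, τ1i < τ → τ < τ2i → deriv (deriv p) τ < 0)
    (h : ℝ → ℝ)
    (hh : ∀ τ : ℝ, 1 < τ → HasDerivAt h (τ * deriv p τ) τ)
    (τpr : ℝ → ℝ)
    (hτpr : ∀ τf ∈ Set.Ioo τ1i τ2i, τpr τf ∈ Set.Ioo 1 τf ∧
      (2 * h (τpr τf) - 2 * h τf) / ((τpr τf) ^ 2 - τf ^ 2) = deriv p τf)
    (τf : ℝ) (hτf : τf ∈ Ioo τ1i τ2i) :
    ∀ τ ∈ Ioo (τpr τf) τf,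
      (2 * h τf - 2 * h (τpr τf)) / (τf ^ 2 - (τpr τf) ^ 2) <
        (2 * h τf - 2 * h τ) / (τf ^ 2 - τ ^ 2) := by
  have hanti : StrictAntiOn (deriv p) (Ioo τ1i τ2i) := by
    refine strictAntiOn_of_deriv_neg (convex_Ioo _ _) ?_ ?_
    · intro x hx
      exact (differentiableAt_of_deriv_ne_zero
        (hp''neg x hx.1 hx.2).ne).continuousAt.continuousWithinAt
    · intro x hx
      rw [interior_Ioo] at hx
      exact hp''neg x hx.1 hx.2
  have hmono : StrictMonoOn (deriv p) (Ioo 1 τ1i) := by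
    refine strictMonoOn_of_deriv_pos (convex_Ioo _ _) ?_ ?_
    · intro x hx
      exact (differentiableAt_of_deriv_ne_zero
        (hp''pos x (Or.inl hx)).ne').continuousAt.continuousWithinAt
    · intro x hx
      rw [interior_Ioo] at hx
      exact hp''pos x (Or.inl hx)
  obtain ⟨⟨hr1, hrf⟩, hEq⟩ := hτpr τf hτf
  obtain ⟨hf1, hf2⟩ := hτf
  set r := τpr τf with hr
  set c := deriv p τf with hc
  let G : ℝ → ℝ := fun x => 2 * h x - 2 * h τf - c * (x ^ 2 - τf ^ 2)
  have hG : ∀ x, 1 < x → HasDerivAt G (2 * x * (deriv p x - c)) x := by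
    intro x hx
    have h1 := (((hh x hx).const_mul 2).sub_const (2 * h τf)).sub
      ((((hasDerivAt_id x).pow 2).sub_const (τf ^ 2)).const_mul c)
    refine h1.congr_deriv ?_
    simp
    ring
  have hGf : G τf = 0 := by simp [G]
  have hne : r ^ 2 - τf ^ 2 < 0 := by nlinarith
  have hGr : G r = 0 := by
    rw [div_eq_iff hne.ne] at hEq
    simp only [G]
    linarith
  have hGm : StrictMonoOn G (Icc τ1i τf) := by
    refine strictMonoOn_of_deriv_pos (convex_Icc _ _) ?_ ?_
    · intro x hx
      exact (hG x (by linarith [hx.1])).continuousAt.continuousWithinAt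
    · intro x hx
      rw [interior_Icc] at hx
      rw [(hG x (by linarith [hx.1])).deriv]
      have h2 := hanti ⟨hx.1, hx.2.trans hf2⟩ ⟨hf1, hf2⟩ hx.2
      have h3 : 0 < x := by linarith [hx.1]
      have h4 : 0 < deriv p x - c := by linarith
      positivity
  have hGneg : ∀ x, τ1i ≤ x → x < τf → G x < 0 := by
    intro x h1 h2
    rw [← hGf]
    exact hGm ⟨h1, h2.le⟩ ⟨hf1.le, le_rfl⟩ h2
  intro τ hτ
  obtain ⟨ht1, ht2⟩ := hτ
  have key : G τ < 0 := by
    by_contra! hcon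
    have htl : τ < τ1i := by
      by_contra! h1
      linarith [hGneg τ h1 ht2]
    obtain ⟨a, ha, hae⟩ := exists_hasDerivAt_eq_slope G (fun x => 2 * x * (deriv p x - c)) ht1
      (fun x hx => (hG x (by linarith [hx.1])).continuousAt.continuousWithinAt)
      (fun x hx => hG x (by linarith [hx.1]))
    obtain ⟨b, hb, hbe⟩ := exists_hasDerivAt_eq_slope G (fun x => 2 * x * (deriv p x - c)) htl
      (fun x hx => (hG x (by linarith [hx.1])).continuousAt.continuousWithinAt)
      (fun x hx => hG x (by linarith [hx.1]))
    have h1 := hGneg τ1i le_rfl hf1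
    have ha0 : 0 ≤ 2 * a * (deriv p a - c) := by
      rw [hae]
      exact div_nonneg (by linarith) (by linarith)
    have hb0 : 2 * b * (deriv p b - c) < 0 := by
      rw [hbe]
      exact div_neg_of_neg_of_pos (by linarith) (by linarith)
    have ha1 : 0 < 2 * a := by linarith [ha.1]
    have hb1 : 0 < 2 * b := by linarith [hb.1, hr1]
    have ha2 := nonneg_of_mul_nonneg_right ha0 ha1
    have hb2 : deriv p b - c < 0 := by
      by_contra! h5
      linarith [mul_nonneg hb1.le h5]
    have := hmono ⟨hr1.trans ha.1, ha.2.trans htl⟩ ⟨by linarith [hb.1], hb.2⟩ (ha.2.trans hb.1)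
    linarith
  have hL : (2 * h τf - 2 * h r) / (τf ^ 2 - r ^ 2) = c := by
    rw [← hEq, ← neg_div_neg_eq]
    congr 1 <;> ring
  rw [hL, lt_div_iff₀ (by nlinarith)]
  simp only [G] at key
  linarith
end

section
/- The function τ_f ↦ τ_pr(τ_f) is strictly decreasing on (τ₁ⁱ, τ₂ⁱ): if τ₁ⁱ < τ_f < τ̃_f < τ₂ⁱ then τ_pr(τ̃_f) < τ_pr(τ_f). -/
open Real Set

/-- The function `τ_f ↦ τ_pr(τ_f)` is strictly decreasing on `(τ₁ⁱ, τ₂ⁱ)`. -/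
theorem stmt10
    (γ S : ℝ) (hγ1 : 1 < γ) (hγ2 : γ < 2) (hS : 0 < S)
    (p : ℝ → ℝ) (hpdef : ∀ τ : ℝ, p τ = S / (τ - 1) ^ γ - 1 / τ ^ 2)
    (τ1i τ2i : ℝ) (hτ1i : 1 < τ1i) (hτi : τ1i < τ2i)
    (hp' : ∀ τ : ℝ, 1 < τ → deriv p τ < 0)
    (hp''pos : ∀ τ : ℝ, (1 < τ ∧ τ < τ1i) ∨ τ2i < τ → 0 < deriv (deriv p) τ)
    (hp''neg : ∀ τ : ℝ, τ1i < τ → τ < τ2i → deriv (deriv p) τ < 0)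
    (h : ℝ → ℝ)
    (hh : ∀ τ : ℝ, 1 < τ → HasDerivAt h (τ * deriv p τ) τ)
    (τpr : ℝ → ℝ)
    (hτpr : ∀ τf ∈ Set.Ioo τ1i τ2i, τpr τf ∈ Set.Ioo 1 τf ∧
      (2 * h (τpr τf) - 2 * h τf) / ((τpr τf) ^ 2 - τf ^ 2) = deriv p τf) :
    ∀ τf τf' : ℝ, τ1i < τf → τf < τf' → τf' < τ2i → τpr τf' < τpr τf := by
  have hcd : ContDiffOn ℝ 1 p (Ioi 1) := by
    have e : p = fun τ : ℝ => S / (τ - 1) ^ γ - 1 / τ ^ 2 := funext hpdef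
    rw [e]
    intro t ht
    have ht1 : (1 : ℝ) < t := ht
    have h1 : t - 1 ≠ 0 := by linarith
    have h2 : t ^ 2 ≠ 0 := by positivity
    have h3 : (t - 1) ^ γ ≠ 0 := (Real.rpow_pos_of_pos (by linarith) γ).ne'
    refine ContDiffAt.contDiffWithinAt ?_
    refine ContDiffAt.sub (ContDiffAt.div contDiffAt_const ?_ h3)
      (ContDiffAt.div contDiffAt_const (contDiffAt_id.pow 2) h2)
    exact ContDiffAt.rpow_const_of_ne (contDiffAt_id.sub contDiffAt_const) h1
  have hcont : ContinuousOn (deriv p) (Ioi 1) :=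
    hcd.continuousOn_deriv_of_isOpen isOpen_Ioi le_rfl
  have hmono : StrictMonoOn (deriv p) (Ioc 1 τ1i) := by
    refine strictMonoOn_of_deriv_pos (convex_Ioc _ _) (hcont.mono fun t ht => ht.1) ?_
    intro t ht
    rw [interior_Ioc] at ht
    exact hp''pos t (Or.inl ht)
  have hanti : StrictAntiOn (deriv p) (Ico τ1i τ2i) := by
    refine strictAntiOn_of_deriv_neg (convex_Ico _ _)
      (hcont.mono fun t ht => lt_of_lt_of_le hτ1i ht.1) ?_
    intro t ht
    rw [interior_Ico] at ht
    exact hp''neg t ht.1 ht.2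
  have hΦ : ∀ c t : ℝ, 1 < t →
      HasDerivAt (fun s => 2 * h s - c * s ^ 2) (2 * t * (deriv p t - c)) t := by
    intro c t ht
    have := ((hh t ht).const_mul 2).sub (((hasDerivAt_id t).pow 2).const_mul c)
    refine this.congr_deriv ?_
    simp
    ring
  have hup : ∀ c u v : ℝ, 1 < u → u < v → (∀ t, u < t → t < v → c < deriv p t) →
      2 * h u - c * u ^ 2 < 2 * h v - c * v ^ 2 := by
    intro c u v hu huv H
    have : StrictMonoOn (fun s => 2 * h s - c * s ^ 2) (Icc u v) := by
      refine strictMonoOn_of_deriv_pos (convex_Icc _ _)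
        (fun t ht => (hΦ c t (lt_of_lt_of_le hu ht.1)).continuousAt.continuousWithinAt) ?_
      intro t ht
      rw [interior_Icc] at ht
      have ht1 : 1 < t := hu.trans ht.1
      rw [(hΦ c t ht1).deriv]
      exact mul_pos (by linarith) (sub_pos.2 (H t ht.1 ht.2))
    exact this ⟨le_rfl, huv.le⟩ ⟨huv.le, le_rfl⟩ huv
  have hdown : ∀ c u v : ℝ, 1 < u → u ≤ v → (∀ t, u < t → t < v → deriv p t < c) →
      2 * h v - c * v ^ 2 ≤ 2 * h u - c * u ^ 2 := by
    intro c u v hu huv H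
    have : StrictAntiOn (fun s => 2 * h s - c * s ^ 2) (Icc u v) := by
      refine strictAntiOn_of_deriv_neg (convex_Icc _ _)
        (fun t ht => (hΦ c t (lt_of_lt_of_le hu ht.1)).continuousAt.continuousWithinAt) ?_
      intro t ht
      rw [interior_Icc] at ht
      have ht1 : 1 < t := hu.trans ht.1
      rw [(hΦ c t ht1).deriv]
      exact mul_neg_of_pos_of_neg (by linarith) (sub_neg.2 (H t ht.1 ht.2))
    exact this.antitoneOn ⟨le_rfl, huv⟩ ⟨huv, le_rfl⟩ huv
  have heq : ∀ x ∈ Ioo τ1i τ2i, 2 * h (τpr x) - deriv p x * (τpr x) ^ 2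
      = 2 * h x - deriv p x * x ^ 2 := by
    intro x hx
    obtain ⟨⟨h1, h2⟩, h3⟩ := hτpr x hx
    have : (τpr x) ^ 2 - x ^ 2 ≠ 0 := by nlinarith
    rw [div_eq_iff this] at h3
    linarith
  intro x y hx hxy hy
  have hxm : x ∈ Ioo τ1i τ2i := ⟨hx, hxy.trans hy⟩
  have hym : y ∈ Ioo τ1i τ2i := ⟨hx.trans hxy, hy⟩
  have ex := heq x hxm
  have ey := heq y hym
  obtain ⟨⟨ha1, hax⟩, -⟩ := hτpr x hxm
  obtain ⟨⟨hb1, hby⟩, -⟩ := hτpr y hym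
  generalize τpr x = a at *
  generalize τpr y = b at *
  have hqxy : deriv p y < deriv p x := hanti ⟨hx.le, hxm.2⟩ ⟨hym.1.le, hy⟩ hxy
  have hqb : deriv p b < deriv p y := by
    by_contra hcon
    push Not at hcon
    have := hup (deriv p y) b y hb1 hby (by
      intro t hbt hty
      rcases le_or_gt τ1i t with h1 | h1
      · exact hanti ⟨h1, hty.trans hy⟩ ⟨hym.1.le, hy⟩ hty
      · exact lt_of_le_of_lt hcon (hmono ⟨hb1, (hbt.trans h1).le⟩ ⟨hb1.trans hbt, h1.le⟩ hbt))
    linarith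
  have hb : b < τ1i := by
    by_contra hcon
    push Not at hcon
    exact absurd (hanti ⟨hcon, hby.trans hy⟩ ⟨hym.1.le, hy⟩ hby) hqb.le.not_gt
  by_contra hab
  push Not at hab
  have h1 := hup (deriv p y) x y (hτ1i.trans hx) hxy (fun t h1 h2 =>
    hanti ⟨(hx.trans h1).le, h2.trans hy⟩ ⟨hym.1.le, hy⟩ h2)
  have h2 := hdown (deriv p y) a b ha1 hab (fun t h1 h2 =>
    (hmono ⟨ha1.trans h1, (h2.trans hb).le⟩ ⟨hb1, hb.le⟩ h2).trans hqb)
  have h3 : 0 < (deriv p x - deriv p y) * (x ^ 2 - a ^ 2) :=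
    mul_pos (by linarith) (by nlinarith)
  nlinarith
end

section
/- Suppose τ_f ∈ (τ₂ⁱ, τ_c). Then p′(τ) < (2h(τ)−2h(τ_f))/(τ²−τ_f²) < p′(τ_f) for every τ ∈ (1, τ_pr(τ_po(τ_f))). -/
open Real Set

/-- Suppose `τ_f ∈ (τ₂ⁱ, τ_c)`. Then
`p'(τ) < (2h(τ)−2h(τ_f))/(τ²−τ_f²) < p'(τ_f)`
for every `τ ∈ (1, τ_pr(τ_po(τ_f)))`. -/
theorem stmt11
    (γ S : ℝ) (hγ1 : 1 < γ) (hγ2 : γ < 2) (hS : 0 < S)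
    (p : ℝ → ℝ) (hpdef : ∀ τ : ℝ, p τ = S / (τ - 1) ^ γ - 1 / τ ^ 2)
    (τ1i τ2i : ℝ) (hτ1i : 1 < τ1i) (hτi : τ1i < τ2i)
    (hp' : ∀ τ : ℝ, 1 < τ → deriv p τ < 0)
    (hp''pos : ∀ τ : ℝ, (1 < τ ∧ τ < τ1i) ∨ τ2i < τ → 0 < deriv (deriv p) τ)
    (hp''neg : ∀ τ : ℝ, τ1i < τ → τ < τ2i → deriv (deriv p) τ < 0)
    (h : ℝ → ℝ)
    (hh : ∀ τ : ℝ, 1 < τ → HasDerivAt h (τ * deriv p τ) τ)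
    (τc : ℝ) (hτc : τ1i < τc)
    (hτceq : deriv p τ1i = (2 * h τc - 2 * h τ1i) / (τc ^ 2 - τ1i ^ 2))
    (τpo : ℝ → ℝ)
    (hτpo : ∀ τf ∈ Set.Ioo τ2i τc, τpo τf ∈ Set.Ioo τ1i τ2i ∧
      deriv p (τpo τf) = (2 * h (τpo τf) - 2 * h τf) / ((τpo τf) ^ 2 - τf ^ 2))
    (τpr : ℝ → ℝ)
    (hτpr : ∀ τf ∈ Set.Ioo τ1i τ2i, τpr τf ∈ Set.Ioo 1 τf ∧
      (2 * h (τpr τf) - 2 * h τf) / ((τpr τf) ^ 2 - τf ^ 2) = deriv p τf)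
    (τf : ℝ) (hτf : τf ∈ Ioo τ2i τc) :
    ∀ τ ∈ Ioo 1 (τpr (τpo τf)),
      deriv p τ < (2 * h τ - 2 * h τf) / (τ ^ 2 - τf ^ 2) ∧
      (2 * h τ - 2 * h τf) / (τ ^ 2 - τf ^ 2) < deriv p τf := by
  have hpfun : p = fun τ : ℝ => S / (τ - 1) ^ γ - 1 / τ ^ 2 := funext hpdef
  have hsm : ContDiffOn ℝ 2 p (Ioi 1) := by
    intro x hx
    have hx1 : (1:ℝ) < x := hx
    have hx0 : x - 1 ≠ 0 := by linarith
    have hpos : (0:ℝ) < x - 1 := by linarith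
    apply ContDiffAt.contDiffWithinAt
    rw [hpfun]
    have h1 : ContDiffAt ℝ 2 (fun τ : ℝ => (τ - 1) ^ γ) x :=
      ContDiffAt.rpow_const_of_ne (by fun_prop) hx0
    have h2 : ContDiffAt ℝ 2 (fun τ : ℝ => τ ^ 2) x := by fun_prop
    exact (contDiffAt_const.div h1 (Real.rpow_pos_of_pos hpos γ).ne').sub
      (contDiffAt_const.div h2 (by positivity))
  have hqc : ContinuousOn (deriv p) (Ioi 1) :=
    hsm.continuousOn_deriv_of_isOpen isOpen_Ioi (by norm_num)
  have mono1 : StrictMonoOn (deriv p) (Ioc 1 τ1i) := by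
    apply strictMonoOn_of_deriv_pos (convex_Ioc 1 τ1i)
    · exact hqc.mono (fun x hx => hx.1)
    · intro x hx
      rw [interior_Ioc] at hx
      exact hp''pos x (Or.inl hx)
  have anti : StrictAntiOn (deriv p) (Icc τ1i τ2i) := by
    apply strictAntiOn_of_deriv_neg (convex_Icc _ _)
    · exact hqc.mono (fun x hx => lt_of_lt_of_le hτ1i hx.1)
    · intro x hx
      rw [interior_Icc] at hx
      exact hp''neg x hx.1 hx.2
  have mono2 : StrictMonoOn (deriv p) (Ici τ2i) := by
    apply strictMonoOn_of_deriv_pos (convex_Ici _)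
    · exact hqc.mono (fun x hx => lt_of_lt_of_le (hτ1i.trans hτi) hx)
    · intro x hx
      rw [interior_Ici] at hx
      exact hp''pos x (Or.inr hx)
  have mvt : ∀ a b : ℝ, 1 < a → a < b →
      ∃ c, a < c ∧ c < b ∧ 2 * h b - 2 * h a = deriv p c * (b ^ 2 - a ^ 2) := by
    intro a b ha hab
    obtain ⟨c, hc, hce⟩ := exists_ratio_hasDerivAt_eq_ratio_slope h (fun x => x * deriv p x) hab
      (fun x hx => (hh x (lt_of_lt_of_le ha hx.1)).continuousAt.continuousWithinAt)
      (fun x hx => hh x (ha.trans hx.1)) (fun x : ℝ => x ^ 2) (fun x => 2 * x)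
      (by fun_prop) (fun x _ => by simpa using hasDerivAt_pow 2 x)
    refine ⟨c, hc.1, hc.2, ?_⟩
    have hc0 : c ≠ 0 := by linarith [hc.1]
    apply mul_left_cancel₀ hc0
    linarith
  obtain ⟨⟨hm1, hm2⟩, hmeq⟩ := hτpo τf hτf
  obtain ⟨⟨hr1, hrm⟩, hreq⟩ := hτpr _ ⟨hm1, hm2⟩
  have hf2 := hτf.1
  generalize τpo τf = m at *
  generalize τpr m = r at *
  rintro τ ⟨ht1, htr⟩
  have e1 : 0 < τf ^ 2 - m ^ 2 := by nlinarith
  have e2 : 0 < m ^ 2 - r ^ 2 := by nlinarith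
  have e3 : 0 < r ^ 2 - τ ^ 2 := by nlinarith
  rw [eq_div_iff (by linarith)] at hmeq
  rw [div_eq_iff (by linarith)] at hreq
  obtain ⟨c, hc1, hc2, hc⟩ := mvt r m hr1 hrm
  obtain ⟨c', hc1', hc2', hc'⟩ := mvt m τf (by linarith) (by linarith)
  obtain ⟨d, hd1, hd2, hd⟩ := mvt τ r ht1 htr
  have hqc1 : deriv p c = deriv p m := by
    apply mul_right_cancel₀ e2.ne'
    linarith
  have hqc2 : deriv p c' = deriv p m := by
    apply mul_right_cancel₀ e1.ne'
    linarith
  have hcl : c < τ1i := by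
    by_contra! hcon
    have := anti (a := c) (b := m) ⟨hcon, by linarith⟩ ⟨hm1.le, hm2.le⟩ hc2
    linarith
  have hcr : τ2i < c' := by
    by_contra! hcon
    have := anti (a := m) (b := c') ⟨hm1.le, hm2.le⟩ ⟨by linarith, hcon⟩ hc1'
    linarith
  have q1 : deriv p c' < deriv p τf := mono2 (mem_Ici.2 hcr.le) (mem_Ici.2 hf2.le) hc2'
  have q2 : deriv p τ < deriv p d := mono1 ⟨ht1, by linarith⟩ ⟨by linarith, by linarith⟩ hd1
  have q3 : deriv p d < deriv p c :=
    mono1 ⟨by linarith, by linarith⟩ ⟨by linarith, hcl.le⟩ (by linarith)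
  have e4 : τ ^ 2 - τf ^ 2 < 0 := by linarith
  rw [lt_div_iff_of_neg e4, div_lt_iff_of_neg e4]
  rw [hqc1] at q3
  rw [hqc2] at q1
  have a1 := mul_lt_mul_of_pos_right q2 e3
  have a2 := mul_lt_mul_of_pos_right q3 e3
  have a3 := mul_lt_mul_of_pos_right (q2.trans q3) (add_pos e1 e2)
  have a4 := mul_lt_mul_of_pos_right q1 (neg_pos.2 e4)
  constructor <;> linarith
end

section
/- Suppose τ_f ∈ (τ₂ⁱ, τ_c). Then for every τ_b ∈ (1, τ_pr(τ_po(τ_f))), Liu's extended entropy condition holds for the pair (τ_b, τ_f): (2h(τ_f)−2h(τ_b))/(τ_f²−τ_b²) < (2h(τ_f)−2h(τ))/(τ_f²−τ²) for all τ ∈ (τ_b, τ_f). -/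
open Real Set

lemma aux_cont (γ S : ℝ) (p : ℝ → ℝ) (hpdef : ∀ τ : ℝ, p τ = S / (τ - 1) ^ γ - 1 / τ ^ 2) :
    ContinuousOn (deriv p) (Ioi 1) := by
  have e : ∀ x ∈ Ioi (1:ℝ), deriv p x =
      S * (-γ * (x - 1) ^ (-γ - 1)) + 2 / x ^ 3 := by
    intro x hx
    have hx : (1:ℝ) < x := hx
    have hx0 : x - 1 > 0 := by linarith
    have h1 : HasDerivAt (fun y : ℝ => (y - 1) ^ (-γ)) (-γ * (x - 1) ^ (-γ - 1)) x := by
      have := ((hasDerivAt_id x).sub_const 1).rpow_const (p := -γ) (Or.inl hx0.ne')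
      exact this.congr_deriv (by simp)
    have h2 : HasDerivAt (fun y : ℝ => (y ^ 2)⁻¹) (-(2 / x ^ 3)) x := by
      have := ((hasDerivAt_id x).pow 2).inv (by simp; linarith)
      refine this.congr_deriv ?_
      have : x ≠ 0 := by linarith
      simp
      field_simp
    have h3 := (h1.const_mul S).sub h2
    have h4 : HasDerivAt p (S * (-γ * (x - 1) ^ (-γ - 1)) - -(2 / x ^ 3)) x := by
      refine h3.congr_of_eventuallyEq ?_
      filter_upwards [Ioi_mem_nhds hx] with y hy
      have hy : (1:ℝ) < y := hy
      simp only [hpdef, Pi.sub_apply]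
      rw [Real.rpow_neg (by linarith)]
      simp [div_eq_mul_inv]
    rw [h4.deriv]; ring
  refine ContinuousOn.congr ?_ e
  intro x hx
  have hx : (1:ℝ) < x := hx
  have h0 : x - 1 ≠ 0 := by linarith
  have h1 : x ^ 3 ≠ 0 := by positivity
  apply ContinuousAt.continuousWithinAt
  have : ContinuousAt (fun y : ℝ => (y - 1) ^ (-γ - 1)) x :=
    (continuousAt_id.sub continuousAt_const).rpow_const (Or.inl h0)
  exact (continuousAt_const.mul (continuousAt_const.mul this)).add
    (continuousAt_const.div (continuousAt_id.pow 3) h1)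

lemma aux_mvt (g h : ℝ → ℝ) (hh : ∀ τ : ℝ, 1 < τ → HasDerivAt h (τ * g τ) τ)
    (x y : ℝ) (hx : 1 < x) (hxy : x < y) :
    ∃ ξ, x < ξ ∧ ξ < y ∧ 2 * h y - 2 * h x = g ξ * (y ^ 2 - x ^ 2) := by
  obtain ⟨ξ, hξ, e⟩ := exists_ratio_hasDerivAt_eq_ratio_slope h (fun t => t * g t) hxy
    (fun t ht => (hh t (lt_of_lt_of_le hx ht.1)).continuousAt.continuousWithinAt)
    (fun t ht => hh t (hx.trans ht.1)) (fun t => t ^ 2) (fun t => 2 * t)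
    (by fun_prop) (fun t _ => by simpa using hasDerivAt_pow 2 t)
  refine ⟨ξ, hξ.1, hξ.2, ?_⟩
  have : ξ ≠ 0 := by linarith [hξ.1]
  apply mul_left_cancel₀ this
  linarith

/-- Suppose `τ_f ∈ (τ₂ⁱ, τ_c)`. Then for every `τ_b ∈ (1, τ_pr(τ_po(τ_f)))`,
Liu's extended entropy condition holds for the pair `(τ_b, τ_f)`. -/
theorem stmt12
    (γ S : ℝ) (hγ1 : 1 < γ) (hγ2 : γ < 2) (hS : 0 < S)
    (p : ℝ → ℝ) (hpdef : ∀ τ : ℝ, p τ = S / (τ - 1) ^ γ - 1 / τ ^ 2)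
    (τ1i τ2i : ℝ) (hτ1i : 1 < τ1i) (hτi : τ1i < τ2i)
    (hp' : ∀ τ : ℝ, 1 < τ → deriv p τ < 0)
    (hp''pos : ∀ τ : ℝ, (1 < τ ∧ τ < τ1i) ∨ τ2i < τ → 0 < deriv (deriv p) τ)
    (hp''neg : ∀ τ : ℝ, τ1i < τ → τ < τ2i → deriv (deriv p) τ < 0)
    (h : ℝ → ℝ)
    (hh : ∀ τ : ℝ, 1 < τ → HasDerivAt h (τ * deriv p τ) τ)
    (τc : ℝ) (hτc : τ1i < τc)
    (hτceq : deriv p τ1i = (2 * h τc - 2 * h τ1i) / (τc ^ 2 - τ1i ^ 2))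
    (τpo : ℝ → ℝ)
    (hτpo : ∀ τf ∈ Set.Ioo τ2i τc, τpo τf ∈ Set.Ioo τ1i τ2i ∧
      deriv p (τpo τf) = (2 * h (τpo τf) - 2 * h τf) / ((τpo τf) ^ 2 - τf ^ 2))
    (τpr : ℝ → ℝ)
    (hτpr : ∀ τf ∈ Set.Ioo τ1i τ2i, τpr τf ∈ Set.Ioo 1 τf ∧
      (2 * h (τpr τf) - 2 * h τf) / ((τpr τf) ^ 2 - τf ^ 2) = deriv p τf)
    (τf : ℝ) (hτf : τf ∈ Ioo τ2i τc) :
    ∀ τb ∈ Ioo 1 (τpr (τpo τf)), ∀ τ ∈ Ioo τb τf,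
      (2 * h τf - 2 * h τb) / (τf ^ 2 - τb ^ 2) <
        (2 * h τf - 2 * h τ) / (τf ^ 2 - τ ^ 2) := by
  have hc := aux_cont γ S p hpdef
  have K := aux_mvt (deriv p) h hh
  have m1 : StrictMonoOn (deriv p) (Ioc 1 τ1i) := by
    apply strictMonoOn_of_deriv_pos (convex_Ioc _ _) (hc.mono fun x hx => hx.1)
    intro x hx
    rw [interior_Ioc] at hx
    exact hp''pos x (Or.inl hx)
  have m2 : StrictAntiOn (deriv p) (Icc τ1i τ2i) := by
    apply strictAntiOn_of_deriv_neg (convex_Icc _ _)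
      (hc.mono fun x hx => lt_of_lt_of_le hτ1i hx.1)
    intro x hx
    rw [interior_Icc] at hx
    exact hp''neg x hx.1 hx.2
  have m3 : StrictMonoOn (deriv p) (Ici τ2i) := by
    apply strictMonoOn_of_deriv_pos (convex_Ici _)
      (hc.mono fun x hx => lt_of_lt_of_le (hτ1i.trans hτi) hx)
    intro x hx
    rw [interior_Ici] at hx
    exact hp''pos x (Or.inr hx)
  obtain ⟨ha, ea⟩ := hτpo τf hτf
  obtain ⟨hb, eb⟩ := hτpr _ ha
  generalize τpo τf = a at *
  generalize τpr a = b0 at *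
  obtain ⟨ha1, ha2⟩ := ha
  obtain ⟨hb1, hb2⟩ := hb
  have hf2 := hτf.1
  generalize deriv p = g at *
  have sq : ∀ x y : ℝ, 1 < x → x < y → 0 < y ^ 2 - x ^ 2 := fun x y _ _ => by nlinarith
  have n1 := sq a τf (by linarith) (by linarith)
  have n2 := sq b0 a hb1 hb2
  rw [eq_div_iff (by linarith)] at ea
  rw [div_eq_iff (by linarith)] at eb
  have g2 : ∀ x, τ1i ≤ x → x < a → g a < g x := fun x h1 h2 =>
    m2 ⟨h1, by linarith⟩ ⟨by linarith, by linarith⟩ h2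
  have g3 : ∀ x, a < x → x ≤ τ2i → g x < g a := fun x h1 h2 =>
    m2 ⟨by linarith, by linarith⟩ ⟨by linarith, by linarith⟩ h1
  have g1 : ∀ x y, 1 < x → x < y → y ≤ τ1i → g x < g y := fun x y h1 h2 h3 =>
    m1 ⟨h1, by linarith⟩ ⟨by linarith, h3⟩ h2
  have g4 : ∀ x y, τ2i ≤ x → x < y → g x < g y := fun x y h1 h2 =>
    m3 h1 (h1.trans h2.le) h2
  -- a point where the slope is attained
  obtain ⟨c, hc1, hc2, hce⟩ := K b0 a hb1 hb2
  have hcg : g c = g a := by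
    apply mul_right_cancel₀ n2.ne'
    linarith
  have hc3 : c < τ1i := by
    by_contra hcon
    have := g2 c (by linarith) hc2
    linarith
  rintro τb ⟨hb3, hb4⟩ τ ⟨ht1, ht2⟩
  have n3 := sq τb τf hb3 (by linarith)
  have n4 := sq τ τf (by linarith) ht2
  have n5 := sq τb b0 hb3 hb4
  have n6 := sq τb τ hb3 ht1
  have n7 := sq b0 τf hb1 (by linarith)
  obtain ⟨d, hd1, hd2, hde⟩ := K τb b0 hb3 hb4
  have hdg : g d < g a := by
    rw [← hcg]
    exact g1 d c (by linarith) (by linarith) hc3.le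
  -- the auxiliary function at `τb` is positive
  have hDb : 0 < 2 * h τb - 2 * h a - g a * (τb ^ 2 - a ^ 2) := by
    linarith [mul_pos (sub_pos.2 hdg) n5]
  rw [div_lt_div_iff₀ n3 n4]
  rcases lt_or_ge τ b0 with hlt | hge
  · obtain ⟨x, hx1, hx2, hxe⟩ := K τb τ hb3 ht1
    obtain ⟨y, hy1, hy2, hye⟩ := K τ b0 (by linarith) hlt
    have hxy : g x < g y := g1 x y (by linarith) (by linarith) (by linarith)
    have hya : g y < g a := by
      rw [← hcg]
      exact g1 y c (by linarith) (by linarith) hc3.le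
    have n8 := sq τ b0 (by linarith) hlt
    have k1 := mul_pos (mul_pos (sub_pos.2 hxy) n6) n4
    have k2 := mul_pos (mul_pos (sub_pos.2 hya) n6) n7
    have e1 : 2 * h τ = 2 * h b0 - g y * (b0 ^ 2 - τ ^ 2) := by linarith
    have e2 : 2 * h τb = 2 * h b0 - g y * (b0 ^ 2 - τ ^ 2) - g x * (τ ^ 2 - τb ^ 2) := by
      linarith
    have e3 : 2 * h τf = 2 * h b0 + g a * (τf ^ 2 - b0 ^ 2) := by linarith
    rw [e1, e2, e3]
    linarith
  · have hD : 2 * h τ - 2 * h a - g a * (τ ^ 2 - a ^ 2) ≤ 0 := by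
      by_contra! hpos
      rcases lt_trichotomy τ a with hta | hta | hta
      · obtain ⟨y, hy1, hy2, hye⟩ := K τ a (by linarith) hta
        have n8 := sq τ a (by linarith) hta
        have hya : g y < g a := by
          by_contra! hcon
          linarith [mul_le_mul_of_nonneg_right hcon n8.le]
        have hy3 : y < τ1i := by
          by_contra! hcon
          linarith [g2 y hcon hy2]
        rcases hge.eq_or_lt with he | hlt
        · subst he
          linarith
        · obtain ⟨x, hx1, hx2, hxe⟩ := K b0 τ hb1 hlt
          have n9 := sq b0 τ hb1 hlt
          have := g1 x y (by linarith) (by linarith) hy3.le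
          linarith [mul_pos (sub_pos.2 (this.trans hya)) n9]
      · subst hta
        linarith
      · obtain ⟨x, hx1, hx2, hxe⟩ := K a τ (by linarith) hta
        obtain ⟨y, hy1, hy2, hye⟩ := K τ τf (by linarith) ht2
        have n8 := sq a τ (by linarith) hta
        have hxa : g a < g x := by
          by_contra! hcon
          linarith [mul_le_mul_of_nonneg_right hcon n8.le]
        have hx3 : τ2i < x := by
          by_contra! hcon
          linarith [g3 x hx1 hcon]
        have := g4 x y hx3.le (by linarith)
        linarith [mul_pos (sub_pos.2 (hxa.trans this)) n4]
    have k1 := mul_pos hDb n4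
    have k2 := mul_nonneg (sub_nonneg.2 hD) n3.le
    have e3 : 2 * h τf = 2 * h a + g a * (τf ^ 2 - a ^ 2) := by linarith
    rw [e3]
    linarith
end

section
/- (Commutator relation between the two wave-characteristic derivatives.) Let I : U → ℝ be twice continuously differentiable. Then at every point of U where sin(2A) ≠ 0: ∂₋∂₊I − ∂₊∂₋I = (1/sin 2A)·[(cos 2A·∂₊β − ∂₋α)·∂₋I − (∂₊β − cos 2A·∂₋α)·∂₊I]. -/
open Real Set

/-- The directional derivative of `f : ℝ² → ℝ` in the direction of angle `θ w`
(at the point `w`): `cos (θ w) ∂ₓf + sin (θ w) ∂_y f`. -/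
noncomputable def dirDeriv (θ : ℝ × ℝ → ℝ) (f : ℝ × ℝ → ℝ) (w : ℝ × ℝ) : ℝ :=
  Real.cos (θ w) * fderiv ℝ f w (1, 0) + Real.sin (θ w) * fderiv ℝ f w (0, 1)

theorem fderiv_dirDeriv_aux (φ f : ℝ × ℝ → ℝ) (z v : ℝ × ℝ)
    (hφ : DifferentiableAt ℝ φ z) (hf : DifferentiableAt ℝ (fderiv ℝ f) z) :
    fderiv ℝ (dirDeriv φ f) z v =
      fderiv ℝ φ z v * (-Real.sin (φ z) * fderiv ℝ f z (1, 0)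
        + Real.cos (φ z) * fderiv ℝ f z (0, 1))
      + Real.cos (φ z) * fderiv ℝ (fderiv ℝ f) z v (1, 0)
      + Real.sin (φ z) * fderiv ℝ (fderiv ℝ f) z v (0, 1) := by
  have h1 := hφ.hasFDerivAt.cos
  have h2 := hφ.hasFDerivAt.sin
  have h3 := hf.hasFDerivAt.clm_apply (hasFDerivAt_const ((1, 0) : ℝ × ℝ) z)
  have h4 := hf.hasFDerivAt.clm_apply (hasFDerivAt_const ((0, 1) : ℝ × ℝ) z)
  have h : HasFDerivAt (dirDeriv φ f) _ z := (h1.mul h3).add (h2.mul h4)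
  rw [h.fderiv]
  simp
  ring

/-- (Commutator relation between the two wave-characteristic derivatives.)
With `∂₊ = cos α ∂ₓ + sin α ∂_y`, `∂₋ = cos β ∂ₓ + sin β ∂_y`, and
`A = (α − β)/2`, for a `C²` function `I` on an open set `U` (with `α, β` being
`C¹`) one has, at every point of `U` where `sin 2A ≠ 0`:
`∂₋∂₊I − ∂₊∂₋I = (1/sin 2A)·[(cos 2A·∂₊β − ∂₋α)·∂₋I − (∂₊β − cos 2A·∂₋α)·∂₊I]`. -/
theorem stmt13
    (U : Set (ℝ × ℝ)) (hU : IsOpen U)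
    (α β I : ℝ × ℝ → ℝ)
    (hα : ContDiffOn ℝ 1 α U) (hβ : ContDiffOn ℝ 1 β U)
    (hI : ContDiffOn ℝ 2 I U) :
    ∀ z ∈ U, Real.sin (2 * ((α z - β z) / 2)) ≠ 0 →
      dirDeriv β (dirDeriv α I) z - dirDeriv α (dirDeriv β I) z =
        (1 / Real.sin (2 * ((α z - β z) / 2))) *
          ((Real.cos (2 * ((α z - β z) / 2)) * dirDeriv α β z - dirDeriv β α z) *
              dirDeriv β I z -
            (dirDeriv α β z - Real.cos (2 * ((α z - β z) / 2)) * dirDeriv β α z) *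
              dirDeriv α I z) := by
  intro z hz hs
  have hUz := hU.mem_nhds hz
  have hαz : DifferentiableAt ℝ α z := (hα.contDiffAt hUz).differentiableAt (by norm_num)
  have hβz : DifferentiableAt ℝ β z := (hβ.contDiffAt hUz).differentiableAt (by norm_num)
  have hIz : ContDiffAt ℝ 2 I z := hI.contDiffAt hUz
  have hI' : DifferentiableAt ℝ (fderiv ℝ I) z :=
    (hIz.fderiv_right (m := 1) (by norm_num)).differentiableAt (by norm_num)
  have hsymm : fderiv ℝ (fderiv ℝ I) z (1, 0) (0, 1) = fderiv ℝ (fderiv ℝ I) z (0, 1) (1, 0) :=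
    (hIz.isSymmSndFDerivAt (by simp)) _ _
  have e1 : dirDeriv β (dirDeriv α I) z = Real.cos (β z) * fderiv ℝ (dirDeriv α I) z (1, 0)
    + Real.sin (β z) * fderiv ℝ (dirDeriv α I) z (0, 1) := rfl
  have e2 : dirDeriv α (dirDeriv β I) z = Real.cos (α z) * fderiv ℝ (dirDeriv β I) z (1, 0)
    + Real.sin (α z) * fderiv ℝ (dirDeriv β I) z (0, 1) := rfl
  rw [e1, e2]
  simp only [fderiv_dirDeriv_aux _ _ _ _ hαz hI', fderiv_dirDeriv_aux _ _ _ _ hβz hI', hsymm]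
  have h2 : 2 * ((α z - β z) / 2) = α z - β z := by ring
  rw [h2] at hs ⊢
  have n1 : Real.cos (α z - β z) * dirDeriv α I z - dirDeriv β I z =
      Real.sin (α z - β z) * (-Real.sin (α z) * fderiv ℝ I z (1, 0)
        + Real.cos (α z) * fderiv ℝ I z (0, 1)) := by
    simp only [dirDeriv, Real.cos_sub, Real.sin_sub]
    linear_combination (Real.cos (β z) * fderiv ℝ I z (1, 0)
      + Real.sin (β z) * fderiv ℝ I z (0, 1)) * Real.sin_sq_add_cos_sq (α z)
  have n2 : dirDeriv α I z - Real.cos (α z - β z) * dirDeriv β I z =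
      Real.sin (α z - β z) * (-Real.sin (β z) * fderiv ℝ I z (1, 0)
        + Real.cos (β z) * fderiv ℝ I z (0, 1)) := by
    simp only [dirDeriv, Real.cos_sub, Real.sin_sub]
    linear_combination -(Real.cos (α z) * fderiv ℝ I z (1, 0)
      + Real.sin (α z) * fderiv ℝ I z (0, 1)) * Real.sin_sq_add_cos_sq (β z)
  have key : (Real.cos (α z - β z) * dirDeriv α β z - dirDeriv β α z) * dirDeriv β I z -
      (dirDeriv α β z - Real.cos (α z - β z) * dirDeriv β α z) * dirDeriv α I z =
      Real.sin (α z - β z) * (dirDeriv β α z * (-Real.sin (α z) * fderiv ℝ I z (1, 0)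
        + Real.cos (α z) * fderiv ℝ I z (0, 1)) - dirDeriv α β z *
        (-Real.sin (β z) * fderiv ℝ I z (1, 0) + Real.cos (β z) * fderiv ℝ I z (0, 1))) := by
    linear_combination dirDeriv β α z * n1 - dirDeriv α β z * n2
  rw [key, one_div, inv_mul_cancel_left₀ hs]
  simp only [dirDeriv]
  ring
end

section
/- (Commutator relation between the stream-line and the plus-characteristic derivatives.) Let I : U → ℝ be twice continuously differentiable. Then at every point of U where sin A ≠ 0: ∂₀∂₊I − ∂₊∂₀I = (1/sin A)·[(cos A·∂₊σ − ∂₀α)·∂₀I − (∂₊σ − cos A·∂₀α)·∂₊I]. -/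
open Real Set

/-- Derivative of the directional derivative of a `C²` function. -/
theorem dirDeriv_fderiv (θ I : ℝ × ℝ → ℝ) (z v : ℝ × ℝ)
    (hθ : DifferentiableAt ℝ θ z) (hI : DifferentiableAt ℝ (fderiv ℝ I) z) :
    fderiv ℝ (dirDeriv θ I) z v =
      fderiv ℝ θ z v * (- Real.sin (θ z) * fderiv ℝ I z (1, 0)
        + Real.cos (θ z) * fderiv ℝ I z (0, 1))
      + Real.cos (θ z) * fderiv ℝ (fderiv ℝ I) z v (1, 0)
      + Real.sin (θ z) * fderiv ℝ (fderiv ℝ I) z v (0, 1) := by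
  have h1 : ∀ e : ℝ × ℝ, HasFDerivAt (fun w => fderiv ℝ I w e)
      ((fderiv ℝ (fderiv ℝ I) z).flip e) z := by
    intro e
    have := hI.hasFDerivAt.clm_apply (hasFDerivAt_const e z)
    simpa using this
  have h2 := (hθ.hasFDerivAt.cos.mul (h1 (1, 0))).add (hθ.hasFDerivAt.sin.mul (h1 (0, 1)))
  have h3 : HasFDerivAt (dirDeriv θ I) _ z := h2
  rw [h3.fderiv]
  simp
  ring

/-- (Commutator relation between the stream-line and plus-characteristic
derivatives.) With `∂₊ = cos α ∂ₓ + sin α ∂_y`, `σ = (α + β)/2`,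
`∂₀ = cos σ ∂ₓ + sin σ ∂_y`, and `A = (α − β)/2`, for a `C²` function `I` on an
open set `U` (with `α, β` being `C¹`) one has, at every point of `U` where
`sin A ≠ 0`:
`∂₀∂₊I − ∂₊∂₀I = (1/sin A)·[(cos A·∂₊σ − ∂₀α)·∂₀I − (∂₊σ − cos A·∂₀α)·∂₊I]`. -/
theorem stmt14
    (U : Set (ℝ × ℝ)) (hU : IsOpen U)
    (α β I : ℝ × ℝ → ℝ)
    (hα : ContDiffOn ℝ 1 α U) (hβ : ContDiffOn ℝ 1 β U)
    (hI : ContDiffOn ℝ 2 I U) :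
    ∀ z ∈ U, Real.sin ((α z - β z) / 2) ≠ 0 →
      dirDeriv (fun w => (α w + β w) / 2) (dirDeriv α I) z -
          dirDeriv α (dirDeriv (fun w => (α w + β w) / 2) I) z =
        (1 / Real.sin ((α z - β z) / 2)) *
          ((Real.cos ((α z - β z) / 2) *
                dirDeriv α (fun w => (α w + β w) / 2) z -
              dirDeriv (fun w => (α w + β w) / 2) α z) *
              dirDeriv (fun w => (α w + β w) / 2) I z -
            (dirDeriv α (fun w => (α w + β w) / 2) z -
              Real.cos ((α z - β z) / 2) *
                dirDeriv (fun w => (α w + β w) / 2) α z) *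
              dirDeriv α I z) := by
  intro z hz hA
  have hUz : U ∈ nhds z := hU.mem_nhds hz
  have dα : DifferentiableAt ℝ α z := (hα.contDiffAt hUz).differentiableAt (by norm_num)
  have dβ : DifferentiableAt ℝ β z := (hβ.contDiffAt hUz).differentiableAt (by norm_num)
  have cI : ContDiffAt ℝ 2 I z := hI.contDiffAt hUz
  have dI : DifferentiableAt ℝ (fderiv ℝ I) z :=
    (cI.fderiv_right (m := 1) (by norm_num)).differentiableAt (by norm_num)
  have hsym : fderiv ℝ (fderiv ℝ I) z (1, 0) (0, 1) = fderiv ℝ (fderiv ℝ I) z (0, 1) (1, 0) :=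
    (cI.isSymmSndFDerivAt (by simp)) (1, 0) (0, 1)
  have dσ : DifferentiableAt ℝ (fun w => (α w + β w) / 2) z := by fun_prop
  have key : ∀ θ f : ℝ × ℝ → ℝ, dirDeriv θ f z =
      Real.cos (θ z) * fderiv ℝ f z (1, 0) + Real.sin (θ z) * fderiv ℝ f z (0, 1) :=
    fun _ _ => rfl
  have hσz : (fun w => (α w + β w) / 2) z = (α z + β z) / 2 := rfl
  generalize (fun w => (α w + β w) / 2) = σ at *
  have hAe : (α z - β z) / 2 = α z - σ z := by rw [hσz]; ring
  rw [hAe] at hA ⊢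
  simp only [key, dirDeriv_fderiv _ _ _ _ dα dI, dirDeriv_fderiv _ _ _ _ dσ dI, hsym]
  rw [one_div, eq_inv_mul_iff_mul_eq₀ hA, Real.sin_sub, Real.cos_sub]
  have ea := Real.sin_sq_add_cos_sq (α z)
  have es := Real.sin_sq_add_cos_sq (σ z)
  generalize Real.sin (α z) = sa at *
  generalize Real.cos (α z) = ca at *
  generalize Real.sin (σ z) = ss at *
  generalize Real.cos (σ z) = cs at *
  generalize fderiv ℝ I z (1, 0) = Ix at *
  generalize fderiv ℝ I z (0, 1) = Iy at *
  generalize fderiv ℝ α z (1, 0) = ax at *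
  generalize fderiv ℝ α z (0, 1) = ay at *
  generalize fderiv ℝ σ z (1, 0) = sx at *
  generalize fderiv ℝ σ z (0, 1) = sy at *
  linear_combination (-(cs * ax + ss * ay) * (cs * Ix + ss * Iy)) * ea
    - ((ca * sx + sa * sy) * (ca * Ix + sa * Iy)) * es
end

section
/- For every γ ∈ (1,2) and every τ > 1, d(τ) − i(τ) = (τ−1)·((γ−2)τ+4)²/(2γ(γ+1)τ⁴); in particular d(τ) ≥ i(τ), with equality if and only if τ = 4/(2−γ). -/
open Real

/-- For every `γ ∈ (1,2)` and `τ > 1`: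
`d(τ) − i(τ) = (τ−1)((γ−2)τ+4)²/(2γ(γ+1)τ⁴)`, hence `d(τ) ≥ i(τ)` with
equality iff `τ = 4/(2−γ)`, where `i` is the inflection-locus curve and `d`
the double-sonic-shock curve of the polytropic van der Waals gas. -/
theorem stmt15
    (γ : ℝ) (hγ1 : 1 < γ) (hγ2 : γ < 2) (τ : ℝ) (hτ : 1 < τ) :
    ((2 - γ) ^ 2 * τ ^ 3 - (2 - γ) * (4 - 3 * γ) * τ ^ 2 - 8 * (γ - 1) * τ - 4) /
        (2 * γ * (γ + 1) * τ ^ 4) -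
      (1 / τ ^ 2) * (6 / (γ * (γ + 1)) * (1 - 1 / τ) ^ 2 - 1) =
      (τ - 1) * ((γ - 2) * τ + 4) ^ 2 / (2 * γ * (γ + 1) * τ ^ 4) ∧
    (1 / τ ^ 2) * (6 / (γ * (γ + 1)) * (1 - 1 / τ) ^ 2 - 1) ≤
      ((2 - γ) ^ 2 * τ ^ 3 - (2 - γ) * (4 - 3 * γ) * τ ^ 2 - 8 * (γ - 1) * τ - 4) /
        (2 * γ * (γ + 1) * τ ^ 4) ∧
    (((2 - γ) ^ 2 * τ ^ 3 - (2 - γ) * (4 - 3 * γ) * τ ^ 2 - 8 * (γ - 1) * τ - 4) /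
        (2 * γ * (γ + 1) * τ ^ 4) =
      (1 / τ ^ 2) * (6 / (γ * (γ + 1)) * (1 - 1 / τ) ^ 2 - 1) ↔
      τ = 4 / (2 - γ)) := by
  have hγ : 0 < γ := by linarith
  have hτ0 : 0 < τ := by linarith
  have hg1 : 0 < γ + 1 := by linarith
  have h2 : 0 < 2 - γ := by linarith
  have hτ1 : 0 < τ - 1 := by linarith
  have hD : 0 < 2 * γ * (γ + 1) * τ ^ 4 := by positivity
  have key : ((2 - γ) ^ 2 * τ ^ 3 - (2 - γ) * (4 - 3 * γ) * τ ^ 2 - 8 * (γ - 1) * τ - 4) /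
        (2 * γ * (γ + 1) * τ ^ 4) -
      (1 / τ ^ 2) * (6 / (γ * (γ + 1)) * (1 - 1 / τ) ^ 2 - 1) =
      (τ - 1) * ((γ - 2) * τ + 4) ^ 2 / (2 * γ * (γ + 1) * τ ^ 4) := by
    field_simp
    ring
  refine ⟨key, ?_, ?_⟩
  · rw [← sub_nonneg, key]
    positivity
  · rw [← sub_eq_zero, key, div_eq_zero_iff, eq_div_iff h2.ne']
    constructor
    · rintro (h | h)
      · rcases mul_eq_zero.mp h with h | h
        · exact absurd h hτ1.ne'
        · have h' := pow_eq_zero_iff (two_ne_zero) |>.mp h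
          linarith
      · exact absurd h hD.ne'
    · intro h
      left
      have h' : (γ - 2) * τ + 4 = 0 := by linarith
      rw [h']
      ring
end

section
/- Fix γ ∈ (1,2) and τ > 1 with τ ≠ 2/(2−γ), and set p = d(τ). Then f(p,τ) > 0, the number η̂ = −(2/τ³ + (γ−2)/τ²)/((γ+1)·τ·f(p,τ)) equals 2/((2−γ)τ − 2), and η̂ is a root of the shock quadratic: ((γ+1)/2)·f(p,τ)·τ·η̂² + (2/τ³ + (γ−2)/τ²)·η̂ + 1/τ³ = 0. Moreover, if 2/(2−γ) < τ < 4/(2−γ), then η̂ > 1 and τ·η̂ > 4/(2−γ). -/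
open Real

/-- Fix `γ ∈ (1,2)` and `τ > 1` with `τ ≠ 2/(2−γ)`, and set `p = d(τ)` (the
double-sonic-shock curve). Then the mass-flux square
`f = γ(pτ²+1)/(τ²(τ−1)) − 2/τ³` is positive, the number
`η̂ = −(2/τ³ + (γ−2)/τ²)/((γ+1)τf)` equals `2/((2−γ)τ−2)` and is a root of the
shock quadratic `((γ+1)/2)fτη² + (2/τ³+(γ−2)/τ²)η + 1/τ³ = 0`; moreover, if
`2/(2−γ) < τ < 4/(2−γ)`, then `η̂ > 1` and `τη̂ > 4/(2−γ)`. -/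
theorem stmt18
    (γ τ : ℝ) (hγ1 : 1 < γ) (hγ2 : γ < 2) (hτ : 1 < τ)
    (hne : τ ≠ 2 / (2 - γ))
    (p f η : ℝ)
    (hp : p = ((2 - γ) ^ 2 * τ ^ 3 - (2 - γ) * (4 - 3 * γ) * τ ^ 2 -
        8 * (γ - 1) * τ - 4) / (2 * γ * (γ + 1) * τ ^ 4))
    (hf : f = γ * (p * τ ^ 2 + 1) / (τ ^ 2 * (τ - 1)) - 2 / τ ^ 3)
    (hη : η = -(2 / τ ^ 3 + (γ - 2) / τ ^ 2) / ((γ + 1) * τ * f)) :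
    0 < f ∧
    η = 2 / ((2 - γ) * τ - 2) ∧
    ((γ + 1) / 2) * f * τ * η ^ 2 + (2 / τ ^ 3 + (γ - 2) / τ ^ 2) * η + 1 / τ ^ 3
      = 0 ∧
    (2 / (2 - γ) < τ → τ < 4 / (2 - γ) → 1 < η ∧ 4 / (2 - γ) < τ * η) := by
  have h0 : τ ≠ 0 := by linarith
  have h1 : τ - 1 ≠ 0 := by linarith
  have hg : γ ≠ 0 := by linarith
  have hg1 : γ + 1 ≠ 0 := by linarith
  have hg2 : 0 < 2 - γ := by linarith
  have hτ0 : 0 < τ := by linarith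
  have hs : (2 - γ) * τ - 2 ≠ 0 := by
    intro h
    apply hne
    rw [eq_div_iff hg2.ne']
    linarith
  have hf' : f = ((2 - γ) * τ - 2) ^ 2 / (2 * (γ + 1) * τ ^ 4) := by
    rw [hf, hp]
    field_simp
    ring
  have hB : 2 / τ ^ 3 + (γ - 2) / τ ^ 2 = -((2 - γ) * τ - 2) / τ ^ 3 := by
    field_simp
    ring
  have hη' : η = 2 / ((2 - γ) * τ - 2) := by
    rw [hη, hf', hB]
    generalize (2 - γ) * τ - 2 = s at hs
    field_simp
  refine ⟨?_, hη', ?_, ?_⟩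
  · rw [hf']
    have : 0 < γ + 1 := by linarith
    positivity
  · rw [hη', hf', hB]
    generalize (2 - γ) * τ - 2 = s at hs
    field_simp
    ring
  · intro ha hb
    rw [div_lt_iff₀ hg2] at ha
    rw [lt_div_iff₀ hg2] at hb
    have hs0 : 0 < (2 - γ) * τ - 2 := by linarith
    rw [hη']
    constructor
    · rw [lt_div_iff₀ hs0]
      linarith
    · rw [← mul_div_assoc, div_lt_div_iff₀ hg2 hs0]
      linarith
end
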